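/- arXiv:2110.08337 — 2 statements merged into one kernel-verified Lean document; each statement's English description precedes it below -/
import Mathlib

section
/- (Carathéodory's theorem) Let B ⊆ ℝⁿ be an open set and let F₁,…,Fₙ : B → ℝ be C^∞ functions with (F₁(x),…,Fₙ(x)) ≠ 0 for every x ∈ B, the coefficient functions of the Pfaffian form δξ = Σᵢ Fᵢ dxᵢ. Then δξ is locally integrable on B if and only if for every point p ∈ B and every open neighborhood M ⊆ B of p there exists a point q ∈ M that is not reachable from p along null curves of δξ contained in M. -/
open Set

/-- Partial derivative of `f : ℝⁿ → ℝ` in the `i`-th coordinate direction. -/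
noncomputable def pd {n : ℕ} (f : (Fin n → ℝ) → ℝ) (i : Fin n) (x : Fin n → ℝ) : ℝ :=
  fderiv ℝ f x (Pi.single i 1)

/-- The Pfaffian form with coefficients `F i` is integrable on `A` if there are `μ`
nowhere zero on `A` and a smooth `ψ` with `Fᵢ = μ · ∂ψ/∂xᵢ` on `A`. -/
def IsIntegrablePfaffOn {n : ℕ} (F : Fin n → (Fin n → ℝ) → ℝ) (A : Set (Fin n → ℝ)) : Prop :=
  ∃ μ ψ : (Fin n → ℝ) → ℝ, (∀ x ∈ A, μ x ≠ 0) ∧ ContDiffOn ℝ (⊤ : ℕ∞) ψ A ∧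
    ∀ i, ∀ x ∈ A, F i x = μ x * pd ψ i x

/-- Local integrability on `B`: every point of `B` has an open neighborhood contained
in `B` on which the form is integrable. -/
def IsLocallyIntegrablePfaffOn {n : ℕ} (F : Fin n → (Fin n → ℝ) → ℝ)
    (B : Set (Fin n → ℝ)) : Prop :=
  ∀ p ∈ B, ∃ A : Set (Fin n → ℝ), A ⊆ B ∧ IsOpen A ∧ p ∈ A ∧ IsIntegrablePfaffOn F A

/-- `q` is reachable from `p` along null curves of the Pfaffian form `Σᵢ Fᵢ dxᵢ` contained
in `M`: there is a piecewise-`C¹` curve `γ : [0,1] → M` (continuous on `[0,1]` and `C¹`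
off a finite set `T`) with `γ 0 = p`, `γ 1 = q`, and `Σᵢ Fᵢ(γ t) · γᵢ′(t) = 0` at every
`t ∈ [0,1]` where `γ` is differentiable. -/
def NullReachable {n : ℕ} (F : Fin n → (Fin n → ℝ) → ℝ) (M : Set (Fin n → ℝ))
    (p q : Fin n → ℝ) : Prop :=
  ∃ γ : ℝ → (Fin n → ℝ), ∃ T : Finset ℝ,
    ContinuousOn γ (Icc 0 1) ∧
    (∀ t ∈ Icc (0 : ℝ) 1, γ t ∈ M) ∧
    γ 0 = p ∧ γ 1 = q ∧
    (∀ t ∈ Icc (0 : ℝ) 1, t ∉ T → ContDiffAt ℝ 1 γ t) ∧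
    (∀ t ∈ Icc (0 : ℝ) 1, DifferentiableAt ℝ γ t → ∑ i, F i (γ t) * deriv γ t i = 0)

open Metric
open scoped Topology ContDiff

section PostComposition

variable {K E F : Type} [TopologicalSpace K] [CompactSpace K]
  [NormedAddCommGroup E] [NormedSpace ℝ E] [NormedAddCommGroup F] [NormedSpace ℝ F]

/-- Pointwise evaluation `A, h ↦ (t ↦ A t (h t))` as a continuous bilinear map. -/
noncomputable def ContinuousMap.applyBilin :
    C(K, E →L[ℝ] F) →L[ℝ] C(K, E) →L[ℝ] C(K, F) :=
  LinearMap.mkContinuous₂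
    (LinearMap.mk₂ ℝ
      (fun (A : C(K, E →L[ℝ] F)) (h : C(K, E)) => (⟨fun t => A t (h t), by fun_prop⟩ : C(K, F)))
      (fun _ _ _ => by ext; simp) (fun _ _ _ => by ext; simp)
      (fun _ _ _ => by ext; simp) (fun _ _ _ => by ext; simp)) 1
    (fun A h => by
      rw [ContinuousMap.norm_le _ (by positivity)]
      intro t
      rw [one_mul]
      exact (A t).le_of_opNorm_le_of_le (A.norm_coe_le_norm t) (h.norm_coe_le_norm t))

theorem ContinuousMap.hasFDerivAt_postcomp (f : C(E, F)) (f' : C(E, E →L[ℝ] F))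
    (hf : ∀ x, HasFDerivAt f (f' x) x) (u : C(K, E)) :
    HasFDerivAt (fun w : C(K, E) => f.comp w) (ContinuousMap.applyBilin (f'.comp u)) u := by
  rw [hasFDerivAt_iff_isLittleO_nhds_zero, Asymptotics.isLittleO_iff]
  intro ε hε
  have hc : IsCompact (Set.range u) := isCompact_range u.continuous
  have hu := hc.uniformContinuousAt_of_continuousAt f' (fun a _ => f'.continuous.continuousAt)
    (Metric.dist_mem_uniformity hε)
  obtain ⟨δ, hδ, H⟩ := Metric.mem_uniformity_dist.1 hu
  filter_upwards [Metric.ball_mem_nhds (0 : C(K, E)) hδ] with h hh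
  rw [mem_ball_zero_iff] at hh
  rw [ContinuousMap.norm_le _ (by positivity)]
  intro t
  have hht : ‖h t‖ ≤ ‖h‖ := h.norm_coe_le_norm t
  have key := Convex.norm_image_sub_le_of_norm_hasFDerivWithin_le' (f := f) (f' := f')
    (φ := f' (u t)) (C := ε) (s := Metric.ball (u t) δ) (x := u t) (y := u t + h t)
    (fun x _ => (hf x).hasFDerivWithinAt)
    (fun x hx => by
      have := H (a := u t) (b := x) (by rwa [dist_comm]) ⟨t, rfl⟩
      rw [← dist_eq_norm, dist_comm]
      exact this.le)
    (convex_ball _ _) (Metric.mem_ball_self hδ)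
    (by simpa [Metric.mem_ball, dist_eq_norm] using hht.trans_lt hh)
  rw [add_sub_cancel_left] at key
  exact key.trans (mul_le_mul_of_nonneg_left hht hε.le)

theorem ContinuousMap.contDiff_postcomp_nat (n : ℕ) :
    ∀ {F : Type} [NormedAddCommGroup F] [NormedSpace ℝ F] (f : C(E, F)), ContDiff ℝ n f →
      ContDiff ℝ n (fun w : C(K, E) => f.comp w) := by
  induction n with
  | zero =>
    intro F _ _ f _
    exact contDiff_zero.2 (ContinuousMap.continuous_postcomp f)
  | succ n ih =>
    intro F _ _ f hf
    push_cast at hf ⊢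
    obtain ⟨f', hf', hd⟩ := contDiff_succ_iff_hasFDerivAt.1 hf
    rw [contDiff_succ_iff_hasFDerivAt]
    let g : C(E, E →L[ℝ] F) := ⟨f', hf'.continuous⟩
    exact ⟨fun w => ContinuousMap.applyBilin (g.comp w),
      (ih g hf').continuousLinearMap_comp ContinuousMap.applyBilin,
      ContinuousMap.hasFDerivAt_postcomp f g hd⟩

theorem ContinuousMap.contDiff_postcomp (f : C(E, F)) (hf : ContDiff ℝ ∞ f) :
    ContDiff ℝ ∞ (fun w : C(K, E) => f.comp w) :=
  contDiff_infty.2 fun n => ContinuousMap.contDiff_postcomp_nat n f (contDiff_infty.1 hf n)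

end PostComposition

/-- A smooth implicit equation is solved by a function smooth on a whole neighbourhood. -/
theorem exists_contDiffOn_implicitFunction {E₁ E₂ G : Type*}
    [NormedAddCommGroup E₁] [NormedSpace ℝ E₁] [CompleteSpace E₁]
    [NormedAddCommGroup E₂] [NormedSpace ℝ E₂] [CompleteSpace E₂]
    [NormedAddCommGroup G] [NormedSpace ℝ G] [CompleteSpace G]
    {f : E₁ × E₂ → G} (hf : ContDiff ℝ ∞ f) (u : E₁ × E₂)
    (hinv : (fderiv ℝ f u ∘L .inr ℝ E₁ E₂).IsInvertible) :
    ∃ z : E₁ → E₂, ∃ U : Set E₁, IsOpen U ∧ u.1 ∈ U ∧ z u.1 = u.2 ∧ ContDiffOn ℝ ∞ z U ∧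
      (∀ x ∈ U, f (x, z x) = f u) ∧ ∀ᶠ v in 𝓝 u, f v = f u → z v.1 = v.2 := by
  have h1 : (∞ : WithTop ℕ∞) ≠ 0 := by simp
  have cd : ∀ v, ContDiffAt ℝ ∞ f v := fun v => hf.contDiffAt
  let z := (cd u).implicitFunction h1 hinv
  have hz0 : z u.1 = u.2 := (cd u).implicitFunction_apply_self h1 hinv
  have hzc : ContDiffAt ℝ ∞ z u.1 := (cd u).contDiffAt_implicitFunction h1 hinv
  have hz1 : ∀ᶠ x in 𝓝 u.1, ContinuousAt z x :=
    ((hzc.of_le (m := 1) (by exact_mod_cast le_top)).eventually (by simp)).mono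
      fun x hx => hx.continuousAt
  have hsol : ∀ᶠ x in 𝓝 u.1, f (x, z x) = f u :=
    (cd u).eventually_apply_implicitFunction h1 hinv
  have huniq := (cd u).eventually_apply_eq_iff_implicitFunction h1 hinv
  have hcomp : ContinuousAt (fun x => (x, z x)) u.1 := continuousAt_id.prodMk hzc.continuousAt
  have hfd : Continuous fun v => fderiv ℝ f v ∘L .inr ℝ E₁ E₂ :=
    (hf.continuous_fderiv h1).clm_comp continuous_const
  have hinv' : ∀ᶠ x in 𝓝 u.1, (fderiv ℝ f (x, z x) ∘L .inr ℝ E₁ E₂).IsInvertible := by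
    obtain ⟨e, he⟩ := hinv
    have h2 : Filter.Tendsto (fun x => fderiv ℝ f (x, z x) ∘L .inr ℝ E₁ E₂) (𝓝 u.1)
        (𝓝 (e : E₂ →L[ℝ] G)) := by
      rw [he]
      have := (hfd.continuousAt (x := (u.1, z u.1))).comp_of_eq hcomp rfl
      simpa [ContinuousAt, hz0, Function.comp_def] using this
    exact h2 e.nhds
  obtain ⟨U, hU, hUo, huU⟩ := _root_.eventually_nhds_iff.1 ((hz1.and hsol).and hinv')
  refine ⟨z, U, hUo, huU, hz0, ?_, fun x hx => (hU x hx).1.2, huniq.mono fun v hv => hv.1⟩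
  intro x hx
  refine ContDiffAt.contDiffWithinAt ?_
  have hi := (hU x hx).2
  have hu2 := (cd (x, z x)).eventually_apply_eq_iff_implicitFunction h1 hi
  have hc2 : ContinuousAt (fun x => (x, z x)) x := continuousAt_id.prodMk (hU x hx).1.1
  refine ((cd (x, z x)).contDiffAt_implicitFunction h1 hi).congr_of_eventuallyEq ?_
  filter_upwards [hc2.eventually hu2, hUo.mem_nhds hx] with y hy hyU
  exact (hy.1 ((hU y hyU).1.2.trans (hU x hx).1.2.symm)).symm

/-- Replacing the `i`-th coordinate by a function `g` with `∂g/∂xᵢ ≠ 0` is a local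
diffeomorphism. -/
theorem exists_openPartialHomeomorph_update {n : ℕ} {g : (Fin n → ℝ) → ℝ} {U : Set (Fin n → ℝ)}
    (hU : IsOpen U) (hg : ContDiffOn ℝ ∞ g U) {x : Fin n → ℝ} (hx : x ∈ U) (i : Fin n)
    (hi : pd g i x ≠ 0) :
    ∃ e : OpenPartialHomeomorph (Fin n → ℝ) (Fin n → ℝ), x ∈ e.source ∧ e.source ⊆ U ∧
      (∀ y, e y = Function.update y i (g y)) ∧ ContDiffOn ℝ ∞ e e.source ∧
      ContDiffOn ℝ ∞ e.symm e.target := by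
  have h1 : (∞ : WithTop ℕ∞) ≠ 0 := by simp
  set Ψ : (Fin n → ℝ) → (Fin n → ℝ) := fun y => Function.update y i (g y) with hΨ
  have hga : ∀ y ∈ U, ContDiffAt ℝ ∞ g y := fun y hy => hg.contDiffAt (hU.mem_nhds hy)
  have hΨa : ∀ y ∈ U, ContDiffAt ℝ ∞ Ψ y := by
    intro y hy
    rw [contDiffAt_pi]
    intro j
    by_cases hj : j = i
    · subst hj; simpa [hΨ] using hga y hy
    · simpa [hΨ, hj] using (contDiff_apply ℝ ℝ j).contDiffAt
  have hderiv : ∀ y ∈ U, pd g i y ≠ 0 →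
      ∃ L : (Fin n → ℝ) ≃L[ℝ] (Fin n → ℝ), HasFDerivAt Ψ (L : (Fin n → ℝ) →L[ℝ] _) y := by
    intro y hy hpd
    have hd := ((hΨa y hy).differentiableAt h1).hasFDerivAt
    have hgd := ((hga y hy).differentiableAt h1).hasFDerivAt
    have hdj : ∀ v j, fderiv ℝ Ψ y v j = if j = i then fderiv ℝ g y v else v j := by
      intro v j
      have h2 := hasFDerivAt_pi'.1 hd j
      by_cases hj : j = i
      · subst hj
        have h3 : HasFDerivAt g ((ContinuousLinearMap.proj j).comp (fderiv ℝ Ψ y)) y := by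
          simpa [hΨ] using h2
        simpa using congrArg (fun A : (Fin n → ℝ) →L[ℝ] ℝ => A v) (h3.unique hgd)
      · have h3 : HasFDerivAt (fun z : Fin n → ℝ => z j)
            ((ContinuousLinearMap.proj j).comp (fderiv ℝ Ψ y)) y := by
          simpa [hΨ, hj] using h2
        simpa [hj] using congrArg (fun A : (Fin n → ℝ) →L[ℝ] ℝ => A v)
          (h3.unique (hasFDerivAt_apply j y))
    have hinj : Function.Injective (fderiv ℝ Ψ y : (Fin n → ℝ) →ₗ[ℝ] (Fin n → ℝ)) := by
      rw [injective_iff_map_eq_zero]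
      intro v hv
      have hv' : ∀ j, fderiv ℝ Ψ y v j = 0 := fun j => congrFun hv j
      have hvj : v = v i • Pi.single i 1 := by
        ext j
        by_cases hj : j = i
        · subst hj; simp
        · have := hv' j
          rw [hdj, if_neg hj] at this
          simp [this, hj]
      have h4 := hv' i
      rw [hdj, if_pos rfl, hvj, map_smul, smul_eq_mul, mul_eq_zero] at h4
      rcases h4 with h4 | h4
      · rw [hvj, h4, zero_smul]
      · exact absurd h4 hpd
    refine ⟨(LinearEquiv.ofInjectiveEndo _ hinj).toContinuousLinearEquiv, ?_⟩
    convert! hd using 1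
  have hcont : ContinuousOn (fun y => pd g i y) U :=
    (hg.continuousOn_fderiv_of_isOpen hU (by exact_mod_cast le_top)).clm_apply continuousOn_const
  have hV : IsOpen (U ∩ (fun y => pd g i y) ⁻¹' {0}ᶜ) :=
    hcont.isOpen_inter_preimage hU isOpen_compl_singleton
  obtain ⟨L, hL⟩ := hderiv x hx hi
  let e := ((hΨa x hx).toOpenPartialHomeomorph Ψ hL h1).restrOpen _ hV
  have hes : e.source ⊆ U ∩ (fun y => pd g i y) ⁻¹' {0}ᶜ := fun y hy => hy.2
  have hcoe : ∀ y, e y = Ψ y := fun y => rfl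
  refine ⟨e, ⟨(hΨa x hx).mem_toOpenPartialHomeomorph_source hL h1, hx, hi⟩,
    fun y hy => (hes hy).1, hcoe, ?_, ?_⟩
  · exact fun y hy => (hΨa y (hes hy).1).contDiffWithinAt
  · intro y hy
    have hs := hes (e.map_target hy)
    obtain ⟨L', hL'⟩ := hderiv _ hs.1 hs.2
    exact (e.contDiffAt_symm hy hL' (hΨa _ hs.1)).contDiffWithinAt

/-- The primitive vanishing at `0`, as an operator on continuous functions on `[0,1]`. -/
noncomputable def unitIntervalPrimitive : C(unitInterval, ℝ) →L[ℝ] C(unitInterval, ℝ) :=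
  LinearMap.mkContinuous
    { toFun := fun f => ⟨fun t => ∫ s in (0 : ℝ)..t, Set.IccExtend zero_le_one f s,
        (intervalIntegral.continuous_primitive (fun a b =>
          (f.continuous.Icc_extend' (h := zero_le_one)).intervalIntegrable a b) 0).comp
            continuous_subtype_val⟩
      map_add' := fun f g => by
        ext t
        exact intervalIntegral.integral_add
          ((f.continuous.Icc_extend' (h := zero_le_one)).intervalIntegrable _ _)
          ((g.continuous.Icc_extend' (h := zero_le_one)).intervalIntegrable _ _)
      map_smul' := fun c f => by
        ext t
        exact intervalIntegral.integral_smul c _ } 1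
    (fun f => by
      rw [ContinuousMap.norm_le _ (by positivity)]
      intro t
      refine (intervalIntegral.norm_integral_le_of_norm_le_const (C := ‖f‖)
        fun s _ => f.norm_coe_le_norm _).trans ?_
      have h0 := t.2.1
      have h1 := t.2.2
      rw [sub_zero, abs_of_nonneg h0, mul_comm]
      exact mul_le_mul_of_nonneg_right h1 (norm_nonneg _))

theorem unitIntervalPrimitive_apply (f : C(unitInterval, ℝ)) (t : unitInterval) :
    unitIntervalPrimitive f t = ∫ s in (0 : ℝ)..t, Set.IccExtend zero_le_one f s := rfl

/-- The path `s ↦ p + s (y - p)` with its `i`-th coordinate replaced by `z s`. -/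
noncomputable def radialPath {n : ℕ} (p : Fin n → ℝ) (i : Fin n)
    (v : (Fin n → ℝ) × C(unitInterval, ℝ)) : C(unitInterval, Fin n → ℝ) :=
  ⟨fun s => Function.update (p + (s : ℝ) • (v.1 - p)) i (v.2 s), by fun_prop⟩

theorem radialPath_apply {n : ℕ} (p : Fin n → ℝ) (i : Fin n)
    (v : (Fin n → ℝ) × C(unitInterval, ℝ)) (s : unitInterval) :
    radialPath p i v s = Function.update (p + (s : ℝ) • (v.1 - p)) i (v.2 s) := rfl

theorem contDiff_radialPath {n : ℕ} (p : Fin n → ℝ) (i : Fin n) :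
    ContDiff ℝ ∞ (radialPath p i) := by
  let L : Fin n → C(unitInterval, ℝ) →L[ℝ] C(unitInterval, Fin n → ℝ) := fun j =>
    (ContinuousLinearMap.single ℝ (fun _ : Fin n => ℝ) j).compLeftContinuous ℝ unitInterval
  let ι : C(unitInterval, ℝ) := ⟨Subtype.val, continuous_subtype_val⟩
  have hL : ∀ j f s k, L j f s k = if k = j then f s else 0 := fun j f s k => by
    rw [← Pi.single_apply]; rfl
  have h : radialPath p i = fun v => ∑ j, L j (if j = i then v.2 else
      ContinuousMap.const _ (p j) + (v.1 j - p j) • ι) := by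
    funext v
    ext s k
    rw [radialPath_apply, ContinuousMap.sum_apply, Finset.sum_apply, Finset.sum_eq_single k]
    · by_cases hk : k = i
      · subst hk; simp [hL]
      · simp [hL, ι, hk, mul_comm]
    · intro j _ hj
      simp [hL, hj.symm]
    · simp
  rw [h]
  refine ContDiff.sum fun j _ => (L j).contDiff.comp ?_
  by_cases hj : j = i
  · simpa [hj] using contDiff_snd
  · simp only [hj, if_false]
    have : ContDiff ℝ ∞ fun v : (Fin n → ℝ) × C(unitInterval, ℝ) => v.1 j :=
      (contDiff_apply ℝ ℝ j).comp contDiff_fst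
    exact contDiff_const.add ((this.sub contDiff_const).smul contDiff_const)

/-- The residual of the integral equation for lifting rays from `p` to curves with velocity
`zᵢ' = Σ_{j ≠ i} aⱼ (yⱼ - pⱼ)` in the `i`-th coordinate. -/
noncomputable def radialResidual {n : ℕ} (p : Fin n → ℝ) (i : Fin n)
    (a : Fin n → C(Fin n → ℝ, ℝ)) (v : (Fin n → ℝ) × C(unitInterval, ℝ)) : C(unitInterval, ℝ) :=
  v.2 - (v.1 i) • (1 : C(unitInterval, ℝ)) - unitIntervalPrimitive
    (∑ j ∈ Finset.univ.erase i, (v.1 j - p j) • (a j).comp (radialPath p i v))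

theorem contDiff_radialResidual {n : ℕ} (p : Fin n → ℝ) (i : Fin n)
    (a : Fin n → C(Fin n → ℝ, ℝ)) (ha : ∀ j, ContDiff ℝ ∞ (a j)) :
    ContDiff ℝ ∞ (radialResidual p i a) := by
  have h : ∀ j, ContDiff ℝ ∞ fun v : (Fin n → ℝ) × C(unitInterval, ℝ) => v.1 j :=
    fun j => (contDiff_apply ℝ ℝ j).comp contDiff_fst
  refine (contDiff_snd.sub ((h i).smul contDiff_const)).sub
    (unitIntervalPrimitive.contDiff.comp (ContDiff.sum fun j _ => ?_))
  exact ((h j).sub contDiff_const).smul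
    ((ContinuousMap.contDiff_postcomp (a j) (ha j)).comp (contDiff_radialPath p i))

theorem radialResidual_apply {n : ℕ} (p : Fin n → ℝ) (i : Fin n)
    (a : Fin n → C(Fin n → ℝ, ℝ)) (v : (Fin n → ℝ) × C(unitInterval, ℝ)) (t : unitInterval) :
    radialResidual p i a v t = v.2 t - v.1 i - ∫ s in (0 : ℝ)..t,
      ∑ j ∈ Finset.univ.erase i, (v.1 j - p j) *
        a j (radialPath p i v (Set.projIcc 0 1 zero_le_one s)) := by
  simp only [radialResidual, ContinuousMap.sub_apply, ContinuousMap.smul_apply,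
    ContinuousMap.one_apply, smul_eq_mul, mul_one, unitIntervalPrimitive_apply, Set.IccExtend,
    Function.comp_apply, ContinuousMap.sum_apply, ContinuousMap.comp_apply]

theorem radialResidual_base {n : ℕ} (p : Fin n → ℝ) (i : Fin n)
    (a : Fin n → C(Fin n → ℝ, ℝ)) (z : C(unitInterval, ℝ)) :
    radialResidual p i a (p, z) = z - (p i) • (1 : C(unitInterval, ℝ)) := by
  simp [radialResidual]

/-- Restricting a solution to `[0, t]` and rescaling solves the equation for the rescaled ray. -/
theorem radialResidual_rescale {n : ℕ} (p : Fin n → ℝ) (i : Fin n)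
    (a : Fin n → C(Fin n → ℝ, ℝ)) (y : Fin n → ℝ) (z : C(unitInterval, ℝ))
    (h : radialResidual p i a (y, z) = 0) (t : unitInterval) :
    radialResidual p i a (Function.update (p + (t : ℝ) • (y - p)) i (y i),
      z.comp ⟨fun s => t * s, by fun_prop⟩) = 0 := by
  ext s
  have hts := congrArg (fun f : C(unitInterval, ℝ) => f (t * s)) h
  simp only [radialResidual_apply, ContinuousMap.zero_apply] at hts
  rw [radialResidual_apply, ContinuousMap.zero_apply]
  refine Eq.trans ?_ hts
  simp only [Function.update_self, ContinuousMap.comp_apply, ContinuousMap.coe_mk]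
  congr 1
  have hcv := intervalIntegral.mul_integral_comp_mul_left (a := 0) (b := (s : ℝ)) (c := (t : ℝ))
    (f := fun r => ∑ j ∈ Finset.univ.erase i, (y j - p j) *
        a j (radialPath p i (y, z) (Set.projIcc 0 1 zero_le_one r)))
  rw [mul_zero] at hcv
  rw [Set.Icc.coe_mul, ← hcv, ← intervalIntegral.integral_const_mul]
  refine intervalIntegral.integral_congr fun r hr => ?_
  rw [Set.uIcc_of_le s.2.1] at hr
  have hr1 : r ∈ Set.Icc (0 : ℝ) 1 := ⟨hr.1, hr.2.trans s.2.2⟩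
  have htr : (t : ℝ) * r ∈ Set.Icc (0 : ℝ) 1 := unitInterval.mul_mem t.2 hr1
  simp only [Finset.mul_sum]
  refine Finset.sum_congr rfl fun j hj => ?_
  have hj' : j ≠ i := Finset.ne_of_mem_erase hj
  have hpath : radialPath p i (Function.update (p + (t : ℝ) • (y - p)) i (y i),
      z.comp ⟨fun s => t * s, by fun_prop⟩) (Set.projIcc 0 1 zero_le_one r) =
      radialPath p i (y, z) (Set.projIcc 0 1 zero_le_one (t * r)) := by
    rw [radialPath_apply, radialPath_apply, Set.projIcc_of_mem _ hr1, Set.projIcc_of_mem _ htr]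
    ext k
    by_cases hk : k = i
    · subst hk
      simp only [Function.update_self, ContinuousMap.comp_apply, ContinuousMap.coe_mk]
      rfl
    · simp [hk]; ring
  rw [hpath]
  simp [hj']
  ring

theorem update_radial_mem_ball {n : ℕ} {p y : Fin n → ℝ} {r : ℝ} (hy : y ∈ ball p r) (i : Fin n)
    {t : ℝ} (ht : t ∈ Icc (0 : ℝ) 1) :
    Function.update (p + t • (y - p)) i (y i) ∈ ball p r := by
  have hr : 0 < r := pos_of_mem_ball hy
  rw [mem_ball, dist_pi_lt_iff hr] at hy ⊢
  intro j
  by_cases hj : j = i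
  · subst hj; simpa using hy j
  · have := hy j
    rw [Real.dist_eq] at this
    have e : Function.update (p + t • (y - p)) i (y i) j - p j = t * (y j - p j) := by
      simp [hj]
    rw [Real.dist_eq, e, abs_mul, abs_of_nonneg ht.1]
    exact (mul_le_of_le_one_left (abs_nonneg _) ht.2).trans_lt this

/-- Lifting the rays issuing from `p`: with `ζ' = Σ_{j ≠ i} aⱼ (yⱼ - pⱼ)` along the ray to `y` and
`ζ 0 = yᵢ`, the end value `W y = ζ 1` depends smoothly on `y`. -/
theorem exists_radial_lift {n : ℕ} (p : Fin n → ℝ) (i : Fin n)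
    (a : Fin n → (Fin n → ℝ) → ℝ) (ha : ∀ j, ContDiff ℝ ∞ (a j)) {δ : ℝ} (hδ : 0 < δ) :
    ∃ r > 0, ∃ W : (Fin n → ℝ) → ℝ, ContDiffOn ℝ ∞ W (ball p r) ∧ pd W i p ≠ 0 ∧ W p = p i ∧
      ∀ y ∈ ball p r, ∃ ζ : ℝ → ℝ, ContDiff ℝ 1 ζ ∧ ζ 0 = y i ∧ ∀ t ∈ Icc (0 : ℝ) 1,
        ζ t = W (Function.update (p + t • (y - p)) i (y i)) ∧ |ζ t - p i| < δ ∧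
        HasDerivAt ζ (∑ j ∈ Finset.univ.erase i,
          (y j - p j) * a j (Function.update (p + t • (y - p)) i (ζ t))) t := by
  let A : Fin n → C(Fin n → ℝ, ℝ) := fun j => ⟨a j, (ha j).continuous⟩
  let c₀ : C(unitInterval, ℝ) := (p i) • 1
  have hG := contDiff_radialResidual p i A ha
  have hG0 : radialResidual p i A (p, c₀) = 0 := by simp [radialResidual_base, c₀]
  have hinv : (fderiv ℝ (radialResidual p i A) (p, c₀) ∘L .inr ℝ _ _).IsInvertible := by
    have h1 : HasFDerivAt (radialResidual p i A) (fderiv ℝ (radialResidual p i A) (p, c₀))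
        ((fun z => (p, z)) c₀) := (hG.differentiable (by simp) _).hasFDerivAt
    have h2 := h1.comp c₀ (hasFDerivAt_prodMk_right p c₀)
    have h3 : HasFDerivAt (radialResidual p i A ∘ fun z => (p, z))
        (ContinuousLinearMap.id ℝ C(unitInterval, ℝ)) c₀ := by
      have : (radialResidual p i A ∘ fun z => (p, z)) = fun z => z - c₀ := by
        funext z; exact radialResidual_base p i A z
      rw [this]
      exact (hasFDerivAt_id c₀).sub_const c₀
    rw [h2.unique h3]
    exact ⟨ContinuousLinearEquiv.refl ℝ _, rfl⟩
  obtain ⟨z, U, hU, hpU, hzp, hzs, hsol, huniq⟩ :=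
    exists_contDiffOn_implicitFunction hG (p, c₀) hinv
  simp only [hG0] at hpU hzp hsol huniq
  obtain ⟨ε, hε, huniq⟩ := Metric.eventually_nhds_iff_ball.1 huniq
  have hzc : ContinuousAt z p := (hzs.continuousOn).continuousAt (hU.mem_nhds hpU)
  have hev : ∀ᶠ y in 𝓝 p, y ∈ U ∧ dist y p < ε ∧ dist (z y) c₀ < min ε δ := by
    refine Filter.Eventually.and (hU.mem_nhds hpU) (Filter.Eventually.and (ball_mem_nhds p hε) ?_)
    have := hzc (ball_mem_nhds (z p) (lt_min hε hδ))
    rwa [hzp] at this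
  obtain ⟨r, hr, hball⟩ := Metric.eventually_nhds_iff_ball.1 hev
  let W : (Fin n → ℝ) → ℝ := fun y => z y 1
  have hW : ContDiffOn ℝ ∞ W (ball p r) :=
    
    (hzs.mono fun y hy => (hball y hy).1).continuousLinearMap_comp
      (ContinuousMap.evalCLM ℝ (1 : unitInterval) : C(unitInterval, ℝ) →L[ℝ] ℝ)
  have hlift : ∀ y ∈ ball p r, ∃ ζ : ℝ → ℝ, ContDiff ℝ 1 ζ ∧ ζ 0 = y i ∧ ∀ t ∈ Icc (0 : ℝ) 1,
        ζ t = W (Function.update (p + t • (y - p)) i (y i)) ∧ |ζ t - p i| < δ ∧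
        HasDerivAt ζ (∑ j ∈ Finset.univ.erase i,
          (y j - p j) * a j (Function.update (p + t • (y - p)) i (ζ t))) t := by
    intro y hy
    obtain ⟨hyU, hyε, hyz⟩ := hball y hy
    have hsy := hsol y hyU
    let g : ℝ → ℝ := fun s => ∑ j ∈ Finset.univ.erase i, (y j - p j) *
        A j (radialPath p i (y, z y) (Set.projIcc 0 1 zero_le_one s))
    have hg : Continuous g := by
      refine continuous_finsetSum _ fun j _ => continuous_const.mul ?_
      exact (A j).continuous.comp
        ((radialPath p i (y, z y)).continuous.comp continuous_projIcc)
    let ζ : ℝ → ℝ := fun t => y i + ∫ s in (0 : ℝ)..t, g s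
    have hζd : ∀ t, HasDerivAt ζ (g t) t := fun t => by
      simpa [ζ] using (intervalIntegral.integral_hasDerivAt_right (hg.intervalIntegrable 0 t)
        (hg.stronglyMeasurableAtFilter _ _) hg.continuousAt).const_add (y i)
    have hζz : ∀ t : unitInterval, ζ t = z y t := by
      intro t
      have := congrArg (fun f : C(unitInterval, ℝ) => f t) hsy
      simp only [radialResidual_apply, ContinuousMap.zero_apply] at this
      simp only [ζ, g]
      linarith
    refine ⟨ζ, ?_, by simp [ζ], ?_⟩
    · rw [contDiff_one_iff_deriv]
      refine ⟨fun t => (hζd t).differentiableAt, ?_⟩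
      rwa [show deriv ζ = g from funext fun t => (hζd t).deriv]
    · intro t ht
      have hζt : ζ t = z y ⟨t, ht⟩ := hζz ⟨t, ht⟩
      refine ⟨?_, ?_, ?_⟩
      · have hresc := radialResidual_rescale p i A y (z y) hsy ⟨t, ht⟩
        have hyt := update_radial_mem_ball hy i ht
        have := huniq (_, (z y).comp ⟨fun s => ⟨t, ht⟩ * s, by fun_prop⟩) ?_ hresc
        · rw [hζt]
          have h1 := congrArg (fun f : C(unitInterval, ℝ) => f 1) this
          simpa [W] using h1.symm
        · rw [mem_ball, Prod.dist_eq, max_lt_iff]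
          refine ⟨(hball _ hyt).2.1, ?_⟩
          rw [ContinuousMap.dist_lt_iff hε]
          intro s
          have := (ContinuousMap.dist_lt_iff (lt_min hε hδ)).1 hyz (⟨t, ht⟩ * s)
          exact this.trans_le (min_le_left _ _)
      · have := (ContinuousMap.dist_lt_iff (lt_min hε hδ)).1 hyz ⟨t, ht⟩
        rw [hζt, ← Real.dist_eq]
        refine (lt_of_eq_of_lt ?_ this).trans_le (min_le_right _ _)
        simp [c₀]
      · convert hζd t using 1
        simp only [g, Set.projIcc_of_mem zero_le_one ht, radialPath_apply, hζt]
        rfl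
  have hWi : ∀ c, Function.update p i c ∈ ball p r → W (Function.update p i c) = c := by
    intro c hc
    obtain ⟨ζ, -, h0, h⟩ := hlift _ hc
    have := (h 0 (by simp)).1
    rw [h0] at this
    simpa using this.symm
  refine ⟨r, hr, W, hW, ?_, by simpa using hWi (p i) (by simpa using hr), hlift⟩
  have hWd : HasFDerivAt W (fderiv ℝ W p) (Function.update p i (p i)) := by
    rw [Function.update_eq_self]
    exact ((hW.contDiffAt (ball_mem_nhds p hr)).differentiableAt (by simp)).hasFDerivAt
  have h1 := hWd.comp_hasDerivAt (p i) (hasDerivAt_update p i (p i))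
  have h2 : HasDerivAt (W ∘ Function.update p i) 1 (p i) := by
    refine (hasDerivAt_id (p i)).congr_of_eventuallyEq ?_
    have hc : ContinuousAt (Function.update p i) (p i) :=
      (continuous_const.update i continuous_id).continuousAt
    have := hc.preimage_mem_nhds (t := ball p r) (by
      rw [Function.update_eq_self]; exact ball_mem_nhds p hr)
    filter_upwards [this] with c hc using hWi c hc
  have h3 := h1.unique h2
  rw [pd, h3]
  exact one_ne_zero

theorem fderiv_apply_eq_sum_pd {n : ℕ} (f : (Fin n → ℝ) → ℝ) (x v : Fin n → ℝ) :
    fderiv ℝ f x v = ∑ i, v i * pd f i x := by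
  refine ((fderiv ℝ f x : (Fin n → ℝ) →ₗ[ℝ] ℝ).pi_apply_eq_sum_univ v).trans ?_
  refine Finset.sum_congr rfl fun i _ => ?_
  rw [smul_eq_mul, pd, ContinuousLinearMap.coe_coe]
  congr 2
  ext j
  simp [Pi.single_apply, eq_comm]

theorem sum_mul_eq_mul_fderiv {n : ℕ} {F : Fin n → (Fin n → ℝ) → ℝ} {ψ : (Fin n → ℝ) → ℝ}
    {x : Fin n → ℝ} {c : ℝ} (h : ∀ i, F i x = c * pd ψ i x) (v : Fin n → ℝ) :
    ∑ i, F i x * v i = c * fderiv ℝ ψ x v := by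
  rw [fderiv_apply_eq_sum_pd, Finset.mul_sum]
  exact Finset.sum_congr rfl fun i _ => by rw [h i]; ring

/-- If `dψ₂` vanishes on the kernel of `dψ₁ ≠ 0`, then `ψ₂` is locally a function of `ψ₁`. -/
theorem exists_nhds_levelSet_subset {n : ℕ} {A : Set (Fin n → ℝ)} (hA : IsOpen A)
    {ψ₁ ψ₂ : (Fin n → ℝ) → ℝ} (h₁ : ContDiffOn ℝ ∞ ψ₁ A) (h₂ : ContDiffOn ℝ ∞ ψ₂ A)
    {x : Fin n → ℝ} (hx : x ∈ A) {i : Fin n} (hi : pd ψ₁ i x ≠ 0)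
    (hker : ∀ y ∈ A, ∀ v, fderiv ℝ ψ₁ y v = 0 → fderiv ℝ ψ₂ y v = 0) :
    ∃ U ∈ 𝓝 x, ∀ y ∈ U, ∀ y' ∈ U, ψ₁ y = ψ₁ y' → ψ₂ y = ψ₂ y' := by
  have h1 : (∞ : WithTop ℕ∞) ≠ 0 := by simp
  obtain ⟨e, hxe, heA, hev, -, hes⟩ := exists_openPartialHomeomorph_update hA h₁ hx i hi
  obtain ⟨r, hr, hball⟩ := Metric.isOpen_iff.1 e.open_target (e x) (e.map_source hxe)
  refine ⟨e.source ∩ e ⁻¹' ball (e x) r,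
    (e.isOpen_inter_preimage isOpen_ball).mem_nhds ⟨hxe, mem_ball_self hr⟩, ?_⟩
  rintro y ⟨hy, hyb⟩ y' ⟨hy', hyb'⟩ hyy
  set w := e y
  set w' := e y'
  have hseg : ∀ t ∈ Icc (0 : ℝ) 1, w + t • (w' - w) ∈ ball (e x) r := fun t ht =>
    (convex_ball _ _).add_smul_sub_mem hyb hyb' ht
  have hd : ∀ t ∈ Icc (0 : ℝ) 1,
      HasDerivAt (fun t : ℝ => ψ₂ (e.symm (w + t • (w' - w)))) 0 t := by
    intro t ht
    set q := w + t • (w' - w) with hq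
    have hqt : q ∈ e.target := hball (hseg t ht)
    have hqA : e.symm q ∈ A := heA (e.map_target hqt)
    have hsd : HasFDerivAt e.symm (fderiv ℝ e.symm q) q :=
      ((hes.contDiffAt (e.open_target.mem_nhds hqt)).differentiableAt h1).hasFDerivAt
    have hd1 : HasFDerivAt ψ₁ (fderiv ℝ ψ₁ (e.symm q)) (e.symm q) :=
      ((h₁.contDiffAt (hA.mem_nhds hqA)).differentiableAt h1).hasFDerivAt
    have hd2 : HasFDerivAt ψ₂ (fderiv ℝ ψ₂ (e.symm q)) (e.symm q) :=
      ((h₂.contDiffAt (hA.mem_nhds hqA)).differentiableAt h1).hasFDerivAt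
    have hl : HasDerivAt (fun t : ℝ => w + t • (w' - w)) (w' - w) t := by
      simpa using ((hasDerivAt_id t).smul_const (w' - w)).const_add w
    have hcoord : ∀ u ∈ e.target, ψ₁ (e.symm u) = u i := by
      intro u hu
      have := congrFun (hev (e.symm u)) i
      rw [e.right_inv hu] at this
      simpa using this.symm
    have hc1 : fderiv ℝ ψ₁ (e.symm q) (fderiv ℝ e.symm q (w' - w)) = 0 := by
      have hA1 : HasFDerivAt (fun u : Fin n → ℝ => u i)
          ((fderiv ℝ ψ₁ (e.symm q)).comp (fderiv ℝ e.symm q)) q := by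
        refine (hd1.comp q hsd).congr_of_eventuallyEq ?_
        filter_upwards [e.open_target.mem_nhds hqt] with u hu using (hcoord u hu).symm
      have := congrArg (fun L : (Fin n → ℝ) →L[ℝ] ℝ => L (w' - w))
        (hA1.unique (hasFDerivAt_apply i q))
      refine Eq.trans this ?_
      have e1 : w i = ψ₁ y := by simp [w, hev]
      have e2 : w' i = ψ₁ y' := by simp [w', hev]
      simp [e1, e2, hyy]
    have := (hd2.comp q hsd).comp_hasDerivAt t hl
    have h0 := hker _ hqA _ hc1
    rw [ContinuousLinearMap.comp_apply, h0] at this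
    exact this
  obtain ⟨c, hc, hslope⟩ := exists_hasDerivAt_eq_slope
    (fun t : ℝ => ψ₂ (e.symm (w + t • (w' - w)))) (fun _ => 0) zero_lt_one
    (fun t ht => (hd t ht).continuousAt.continuousWithinAt)
    (fun t ht => hd t (Ioo_subset_Icc_self ht))
  have : ψ₂ (e.symm w') = ψ₂ (e.symm w) := by
    have h : 0 = ψ₂ (e.symm w') - ψ₂ (e.symm w) := by simpa using hslope
    linarith
  rw [e.left_inv hy, e.left_inv hy'] at this
  exact this.symm

/-- A first integral of a form is constant along null curves. -/
theorem eq_of_null_curve {n : ℕ} {F : Fin n → (Fin n → ℝ) → ℝ} {A : Set (Fin n → ℝ)}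
    (hA : IsOpen A) {μ ψ : (Fin n → ℝ) → ℝ} (hμ : ∀ x ∈ A, μ x ≠ 0) (hψ : ContDiffOn ℝ ∞ ψ A)
    (hF : ∀ i, ∀ x ∈ A, F i x = μ x * pd ψ i x) {γ : ℝ → Fin n → ℝ} {a b : ℝ} (hab : a < b)
    (hγ : ContinuousOn γ (Icc a b)) (hγA : ∀ t ∈ Icc a b, γ t ∈ A)
    (hd : ∀ t ∈ Ioo a b, DifferentiableAt ℝ γ t)
    (hnull : ∀ t ∈ Ioo a b, ∑ i, F i (γ t) * deriv γ t i = 0) : ψ (γ a) = ψ (γ b) := by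
  obtain ⟨c, hc, hslope⟩ := exists_hasDerivAt_eq_slope (ψ ∘ γ) (fun _ => 0) hab
    (hψ.continuousOn.comp hγ hγA) (fun t ht => by
      have htA := hγA t (Ioo_subset_Icc_self ht)
      have h1 := ((hψ.contDiffAt (hA.mem_nhds htA)).differentiableAt
        (by simp)).hasFDerivAt.comp_hasDerivAt t (hd t ht).hasDerivAt
      have h2 := hnull t ht
      rw [sum_mul_eq_mul_fderiv (fun i => hF i _ htA), mul_eq_zero, or_iff_right (hμ _ htA)] at h2
      rwa [h2] at h1)
  have h3 : ψ (γ b) - ψ (γ a) = 0 := by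
    rcases div_eq_zero_iff.1 hslope.symm with h | h
    · exact h
    · linarith
  linarith

theorem IsIntegrablePfaffOn.mono {n : ℕ} {F : Fin n → (Fin n → ℝ) → ℝ} {A A' : Set (Fin n → ℝ)}
    (h : IsIntegrablePfaffOn F A) (hA : A' ⊆ A) : IsIntegrablePfaffOn F A' := by
  obtain ⟨μ, ψ, h1, h2, h3⟩ := h
  exact ⟨μ, ψ, fun x hx => h1 x (hA hx), h2.mono hA, fun i x hx => h3 i x (hA hx)⟩

/-- In an open set on which a nonvanishing form is locally integrable, a single point cannot reach
all others: the reachable set meets countably many level sets of the local first integrals. -/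
theorem exists_not_nullReachable {n : ℕ} {F : Fin n → (Fin n → ℝ) → ℝ} {M : Set (Fin n → ℝ)}
    (hF0 : ∀ x ∈ M, (fun i => F i x) ≠ 0) (hFint : IsLocallyIntegrablePfaffOn F M)
    {p : Fin n → ℝ} (hp : p ∈ M) : ∃ q ∈ M, ¬ NullReachable F M p q := by
  by_contra! hreach
  choose! A hAM hAo hxA μ ψ hμ hψ hFψ using hFint
  have hpd : ∀ k ∈ M, ∀ x ∈ A k, ∃ i, pd (ψ k) i x ≠ 0 := by
    intro k hk x hx
    by_contra! hall
    exact hF0 x (hAM k hk hx) (funext fun i => by rw [hFψ k hk i x hx, hall i, mul_zero]; rfl)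
  obtain ⟨X, hXM, hXc, hcov⟩ := TopologicalSpace.countable_cover_nhdsWithin
    (f := A) (s := M) fun x hx => mem_nhdsWithin_of_mem_nhds ((hAo x hx).mem_nhds (hxA x hx))
  have hcov' : ∀ x ∈ M, ∃ k ∈ X, x ∈ A k := fun x hx => by simpa using hcov hx
  -- the values of `ψ j` on a level set of `ψ k`
  let succ : (Fin n → ℝ) × ℝ → Set ((Fin n → ℝ) × ℝ) := fun kc =>
    ⋃ j ∈ X, (fun y => (j, ψ j y)) '' {y | y ∈ A kc.1 ∩ A j ∧ ψ kc.1 y = kc.2}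
  have hsucc : ∀ kc : (Fin n → ℝ) × ℝ, kc.1 ∈ M → (succ kc).Countable := by
    rintro ⟨k, c⟩ hk
    refine hXc.biUnion fun j hj => ?_
    have hjM := hXM hj
    have hloc : ∀ x ∈ {y | y ∈ A k ∩ A j ∧ ψ k y = c}, ∃ U ∈ 𝓝 x,
        ∀ y ∈ U, ∀ y' ∈ U, ψ k y = ψ k y' → ψ j y = ψ j y' := by
      rintro x ⟨hx, -⟩
      obtain ⟨i, hi⟩ := hpd k hk x hx.1
      refine exists_nhds_levelSet_subset ((hAo k hk).inter (hAo j hjM))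
        ((hψ k hk).mono inter_subset_left) ((hψ j hjM).mono inter_subset_right) hx hi ?_
      intro y hy v hv
      have e1 := sum_mul_eq_mul_fderiv (fun i => hFψ k hk i y hy.1) v
      have e2 := sum_mul_eq_mul_fderiv (fun i => hFψ j hjM i y hy.2) v
      rw [hv, mul_zero] at e1
      rw [e1] at e2
      exact (mul_eq_zero.1 e2.symm).resolve_left (hμ j hjM y hy.2)
    choose! U hU hUc using hloc
    obtain ⟨Y, hYL, hYc, hYcov⟩ := TopologicalSpace.countable_cover_nhdsWithin
      fun x hx => mem_nhdsWithin_of_mem_nhds (hU x hx)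
    refine (hYc.image fun y => (j, ψ j y)).mono ?_
    rintro _ ⟨y, hy, rfl⟩
    obtain ⟨x, hxY, hyx⟩ := mem_iUnion₂.1 (hYcov hy)
    exact ⟨x, hxY, by
      simp [hUc x (hYL hxY) x (mem_of_mem_nhds (hU x (hYL hxY))) y hyx
        ((hYL hxY).2.trans hy.2.symm)]⟩
  let S : ℕ → Set ((Fin n → ℝ) × ℝ) := fun m =>
    Nat.rec ((fun k => (k, ψ k p)) '' X) (fun _ s => ⋃ kc ∈ s, succ kc) m
  have hSX : ∀ m, ∀ kc ∈ S m, kc.1 ∈ X := by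
    intro m
    induction m with
    | zero => rintro _ ⟨k, hk, rfl⟩; exact hk
    | succ m ih =>
      intro kc hkc
      obtain ⟨kc', -, h⟩ := mem_iUnion₂.1 hkc
      obtain ⟨j, hj, y, -, rfl⟩ := mem_iUnion₂.1 h
      exact hj
  have hSc : ∀ m, (S m).Countable := by
    intro m
    induction m with
    | zero => exact hXc.image _
    | succ m ih => exact ih.biUnion fun kc hkc => hsucc kc (hXM (hSX m kc hkc))
  let Z : Set (Fin n → ℝ) := {q | ∀ j ∈ X, q ∈ A j → (j, ψ j q) ∈ ⋃ m, S m}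
  have hZ : ∀ q, ∀ k ∈ X, q ∈ A k → (k, ψ k q) ∈ ⋃ m, S m → q ∈ Z := by
    intro q k hk hq hkq j hj hqj
    obtain ⟨m, hm⟩ := mem_iUnion.1 hkq
    exact mem_iUnion.2 ⟨m + 1, mem_iUnion₂.2 ⟨_, hm,
      mem_iUnion₂.2 ⟨j, hj, q, ⟨⟨hq, hqj⟩, rfl⟩, rfl⟩⟩⟩
  have hpZ : p ∈ Z := fun j hj _ => mem_iUnion.2 ⟨0, j, hj, rfl⟩
  have hMZ : M ⊆ Z := by
    intro q hq
    obtain ⟨γ, T, hγc, hγM, h0, h1, hγd, hγn⟩ := hreach q hq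
    have key : (γ 0 ∈ Z ↔ γ 1 ∈ Z) := by
      refine isPreconnected_Icc.induction₂ (s := Icc (0 : ℝ) 1) (fun s t => (γ s ∈ Z ↔ γ t ∈ Z)) ?_
        (fun _ _ _ _ _ _ h h' => h.trans h') (fun _ _ _ _ h => h.symm) (by simp) (by simp)
      intro t ht
      obtain ⟨k, hk, htk⟩ := hcov' _ (hγM t ht)
      have hkM := hXM hk
      have hn1 : ∀ᶠ s in 𝓝 t, s ∈ Icc (0 : ℝ) 1 → γ s ∈ A k :=
        eventually_nhdsWithin_iff.1 ((hγc t ht).eventually ((hAo k hkM).mem_nhds htk))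
      have hn2 : ∀ᶠ s in 𝓝 t, s ∉ T \ {t} :=
        (T \ {t}).finite_toSet.isClosed.isOpen_compl.mem_nhds (by simp)
      obtain ⟨δ, hδ, hball⟩ := Metric.eventually_nhds_iff_ball.1 (hn1.and hn2)
      have hconst : ∀ a b, a < b → a ∈ Icc (0 : ℝ) 1 → b ∈ Icc (0 : ℝ) 1 → a ∈ ball t δ →
          b ∈ ball t δ → t ∉ Ioo a b → ψ k (γ a) = ψ k (γ b) := by
        intro a b hab ha hb hat hbt htab
        have hsub : Icc a b ⊆ Icc 0 1 := Icc_subset_Icc ha.1 hb.2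
        have hsub' : Icc a b ⊆ ball t δ := by
          rw [Real.ball_eq_Ioo] at *
          exact fun s hs => ⟨hat.1.trans_le hs.1, hs.2.trans_lt hbt.2⟩
        have hdiff : ∀ s ∈ Ioo a b, DifferentiableAt ℝ γ s := by
          intro s hs
          have hs' := Ioo_subset_Icc_self hs
          refine (hγd s (hsub hs') fun hsT => ?_).differentiableAt one_ne_zero
          refine (hball s (hsub' hs')).2 (Finset.mem_sdiff.2 ⟨hsT, ?_⟩)
          rw [Finset.mem_singleton]
          rintro rfl
          exact htab hs
        exact eq_of_null_curve (hAo k hkM) (hμ k hkM) (hψ k hkM) (hFψ k hkM) hab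
          (hγc.mono hsub) (fun s hs => (hball s (hsub' hs)).1 (hsub hs)) hdiff
          (fun s hs => hγn s (hsub (Ioo_subset_Icc_self hs)) (hdiff s hs))
      filter_upwards [mem_nhdsWithin_of_mem_nhds (ball_mem_nhds t hδ), self_mem_nhdsWithin]
        with s hsb hs
      have hsk : γ s ∈ A k := (hball s hsb).1 hs
      have hst : ψ k (γ t) = ψ k (γ s) := by
        rcases lt_trichotomy t s with h | rfl | h
        · exact hconst t s h ht hs (mem_ball_self hδ) hsb (by simp)
        · rfl
        · exact (hconst s t h hs ht hsb (mem_ball_self hδ) (by simp)).symm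
      exact ⟨fun h => hZ _ k hk hsk (hst ▸ h k hk htk), fun h => hZ _ k hk htk (hst ▸ h k hk hsk)⟩
    rw [h0, h1] at key
    exact key.1 hpZ
  obtain ⟨k, hk, hpk⟩ := hcov' p hp
  have hkM := hXM hk
  have hcount : (ψ k '' A k).Countable := by
    refine ((countable_iUnion hSc).image Prod.snd).mono ?_
    rintro _ ⟨q, hq, rfl⟩
    exact ⟨_, hMZ (hAM k hkM hq) k hk hq, rfl⟩
  have hnhds : ψ k '' A k ∈ 𝓝 (ψ k p) := by
    have hs : HasStrictFDerivAt (ψ k) (fderiv ℝ (ψ k) p) p :=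
      ((hψ k hkM).contDiffAt ((hAo k hkM).mem_nhds hpk)).hasStrictFDerivAt (by simp)
    obtain ⟨i, hi⟩ := hpd k hkM p hpk
    rw [← hs.map_nhds_eq_of_surj]
    · exact Filter.image_mem_map ((hAo k hkM).mem_nhds hpk)
    · refine LinearMap.range_eq_top.2 (LinearMap.surjective fun h0 => hi ?_)
      exact congrArg (fun L : (Fin n → ℝ) →ₗ[ℝ] ℝ => L (Pi.single i 1)) h0
  have hd := hcount.dense_compl ℝ
  rw [← interior_eq_empty_iff_dense_compl] at hd
  exact (hd ▸ mem_interior_iff_mem_nhds.2 hnhds : ψ k p ∈ (∅ : Set ℝ))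

/-- A variant of `NullReachable` in which the null condition is imposed on derivatives within
`[0,1]`, so that curves can be concatenated. -/
def StronglyNullReachable {n : ℕ} (F : Fin n → (Fin n → ℝ) → ℝ) (M : Set (Fin n → ℝ))
    (p q : Fin n → ℝ) : Prop :=
  ∃ γ : ℝ → (Fin n → ℝ), ∃ T : Finset ℝ,
    ContinuousOn γ (Icc 0 1) ∧
    (∀ t ∈ Icc (0 : ℝ) 1, γ t ∈ M) ∧
    γ 0 = p ∧ γ 1 = q ∧
    (∀ t ∈ Icc (0 : ℝ) 1, t ∉ T → ContDiffAt ℝ 1 γ t) ∧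
    (∀ t ∈ Icc (0 : ℝ) 1, ∀ v, HasDerivWithinAt γ v (Icc 0 1) t → ∑ i, F i (γ t) * v i = 0)

namespace StronglyNullReachable

variable {n : ℕ} {F : Fin n → (Fin n → ℝ) → ℝ} {M : Set (Fin n → ℝ)} {p q r : Fin n → ℝ}

theorem nullReachable (h : StronglyNullReachable F M p q) : NullReachable F M p q := by
  obtain ⟨γ, T, hc, hM, h0, h1, hd, hn⟩ := h
  exact ⟨γ, T, hc, hM, h0, h1, hd, fun t ht hdt => hn t ht _ hdt.hasDerivAt.hasDerivWithinAt⟩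

theorem of_hasDerivAt {γ γ' : ℝ → Fin n → ℝ} (h0 : γ 0 = p) (h1 : γ 1 = q)
    (hM : ∀ t ∈ Icc (0 : ℝ) 1, γ t ∈ M) (hd : ∀ t ∈ Icc (0 : ℝ) 1, ContDiffAt ℝ 1 γ t)
    (hγ' : ∀ t ∈ Icc (0 : ℝ) 1, HasDerivAt γ (γ' t) t)
    (hn : ∀ t ∈ Icc (0 : ℝ) 1, ∑ i, F i (γ t) * γ' t i = 0) :
    StronglyNullReachable F M p q := by
  refine ⟨γ, ∅, fun t ht => (hd t ht).continuousAt.continuousWithinAt, hM, h0, h1,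
    fun t ht _ => hd t ht, fun t ht v hv => ?_⟩
  rw [(uniqueDiffOn_Icc zero_lt_one t ht).eq_deriv _ hv (hγ' t ht).hasDerivWithinAt]
  exact hn t ht

theorem symm (h : StronglyNullReachable F M p q) : StronglyNullReachable F M q p := by
  classical
  obtain ⟨γ, T, hc, hM, h0, h1, hd, hn⟩ := h
  have hmaps : MapsTo (fun t : ℝ => 1 - t) (Icc 0 1) (Icc 0 1) := fun t ht =>
    ⟨by linarith [ht.2], by linarith [ht.1]⟩
  refine ⟨fun t => γ (1 - t), T.image fun t => 1 - t, hc.comp (by fun_prop) hmaps,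
    fun t ht => hM _ (hmaps ht), by simpa using h1, by simpa using h0, ?_, ?_⟩
  · intro t ht htT
    have h2 : 1 - t ∉ T := fun h => htT (Finset.mem_image.2 ⟨_, h, by ring⟩)
    exact (hd _ (hmaps ht) h2).comp t (contDiff_const.sub contDiff_id).contDiffAt
  · intro t ht v hv
    have hl : HasDerivWithinAt (fun s : ℝ => 1 - s) (-1) (Icc 0 1) (1 - t) := by
      simpa using ((hasDerivAt_id (1 - t)).const_sub 1).hasDerivWithinAt
    have hv' : HasDerivWithinAt (fun t => γ (1 - t)) v (Icc 0 1)
        ((fun s : ℝ => 1 - s) (1 - t)) := by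
      simpa using hv
    have h3 := hv'.scomp (1 - t) hl hmaps
    have h4 := hn _ (hmaps ht) _ (by simpa [Function.comp_def] using h3)
    simpa using h4

theorem trans (h : StronglyNullReachable F M p q) (h' : StronglyNullReachable F M q r) :
    StronglyNullReachable F M p r := by
  classical
  obtain ⟨γ, T, hc, hM, h0, h1, hd, hn⟩ := h
  obtain ⟨γ', T', hc', hM', h0', h1', hd', hn'⟩ := h'
  let α : ℝ → Fin n → ℝ := fun t => if t ≤ 1 / 2 then γ (2 * t) else γ' (2 * t - 1)
  have hα : ∀ t ≤ 1 / 2, α t = γ (2 * t) := fun t ht => if_pos ht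
  have hα' : ∀ t, 1 / 2 ≤ t → α t = γ' (2 * t - 1) := by
    intro t ht
    rcases ht.eq_or_lt with rfl | ht
    · rw [hα _ le_rfl]; norm_num [h1, h0']
    · exact if_neg ht.not_ge
  have m1 : ∀ t ∈ Icc (0 : ℝ) (1 / 2), 2 * t ∈ Icc (0 : ℝ) 1 := fun t ht =>
    ⟨by linarith [ht.1], by linarith [ht.2]⟩
  have m2 : ∀ t ∈ Icc (1 / 2 : ℝ) 1, 2 * t - 1 ∈ Icc (0 : ℝ) 1 := fun t ht =>
    ⟨by linarith [ht.1], by linarith [ht.2]⟩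
  have hsplit : Icc (0 : ℝ) 1 = Icc 0 (1 / 2) ∪ Icc (1 / 2) 1 :=
    (Icc_union_Icc_eq_Icc (by norm_num) (by norm_num)).symm
  refine ⟨α, insert (1 / 2) (T.image (fun t => t / 2) ∪ T'.image fun t => (t + 1) / 2),
    ?_, ?_, ?_, ?_, ?_, ?_⟩
  · rw [hsplit]
    refine ContinuousOn.union_of_isClosed ?_ ?_ isClosed_Icc isClosed_Icc
    · exact (hc.comp (by fun_prop) m1).congr fun t ht => hα t ht.2
    · exact (hc'.comp (by fun_prop) m2).congr fun t ht => hα' t ht.1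
  · intro t ht
    rw [hsplit] at ht
    rcases ht with ht | ht
    · rw [hα t ht.2]; exact hM _ (m1 t ht)
    · rw [hα' t ht.1]; exact hM' _ (m2 t ht)
  · rw [hα 0 (by norm_num)]; simpa using h0
  · rw [hα' 1 (by norm_num)]; norm_num [h1']
  · intro t ht htT
    simp only [Finset.mem_insert, Finset.mem_union, Finset.mem_image, not_or] at htT
    obtain ⟨hne, hT, hT'⟩ := htT
    rcases lt_or_gt_of_ne hne with hlt | hgt
    · have h2 : 2 * t ∉ T := fun h => hT ⟨_, h, by ring⟩
      have h3 : ContDiffAt ℝ 1 (fun s : ℝ => γ (2 * s)) t :=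
        (hd _ (m1 t ⟨ht.1, hlt.le⟩) h2).comp t (contDiff_const.mul contDiff_id).contDiffAt
      refine h3.congr_of_eventuallyEq ?_
      filter_upwards [Iio_mem_nhds hlt] with s hs using hα s (le_of_lt hs)
    · have h2 : 2 * t - 1 ∉ T' := fun h => hT' ⟨_, h, by ring⟩
      have h3 : ContDiffAt ℝ 1 (fun s : ℝ => γ' (2 * s - 1)) t :=
        (hd' _ (m2 t ⟨le_of_lt hgt, ht.2⟩) h2).comp t
          ((contDiff_const.mul contDiff_id).sub contDiff_const).contDiffAt
      refine h3.congr_of_eventuallyEq ?_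
      filter_upwards [Ioi_mem_nhds hgt] with s hs using hα' s (le_of_lt hs)
  · intro t ht v hv
    rw [hsplit] at ht
    rcases ht with ht | ht
    · have hmaps : MapsTo (fun s : ℝ => s / 2) (Icc 0 1) (Icc 0 1) := fun s hs =>
        ⟨by linarith [hs.1], by linarith [hs.1, hs.2]⟩
      have hl : HasDerivWithinAt (fun s : ℝ => s / 2) (1 / 2) (Icc 0 1) (2 * t) :=
        ((hasDerivAt_id (2 * t)).div_const 2).hasDerivWithinAt
      have hv' : HasDerivWithinAt α v (Icc 0 1) ((fun s : ℝ => s / 2) (2 * t)) := by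
        convert hv using 1; ring
      have h3 : HasDerivWithinAt γ ((1 / 2 : ℝ) • v) (Icc 0 1) (2 * t) := by
        refine (hv'.scomp (2 * t) hl hmaps).congr_of_mem (fun s hs => ?_) (m1 t ht)
        rw [Function.comp_apply, hα _ (by linarith [hs.2])]
        congr 1; ring
      have h4 := hn _ (m1 t ht) _ h3
      rw [hα t ht.2]
      simp only [Pi.smul_apply, smul_eq_mul, mul_left_comm _ (1 / 2 : ℝ), ← Finset.mul_sum] at h4
      exact (mul_eq_zero.1 h4).resolve_left (by norm_num)
    · have hmaps : MapsTo (fun s : ℝ => (s + 1) / 2) (Icc 0 1) (Icc 0 1) := fun s hs =>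
        ⟨by linarith [hs.1], by linarith [hs.1, hs.2]⟩
      have hl : HasDerivWithinAt (fun s : ℝ => (s + 1) / 2) (1 / 2) (Icc 0 1) (2 * t - 1) :=
        (((hasDerivAt_id (2 * t - 1)).add_const 1).div_const 2).hasDerivWithinAt
      have hv' : HasDerivWithinAt α v (Icc 0 1) ((fun s : ℝ => (s + 1) / 2) (2 * t - 1)) := by
        convert hv using 1; ring
      have h3 : HasDerivWithinAt γ' ((1 / 2 : ℝ) • v) (Icc 0 1) (2 * t - 1) := by
        refine (hv'.scomp (2 * t - 1) hl hmaps).congr_of_mem (fun s hs => ?_) (m2 t ht)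
        rw [Function.comp_apply, hα' _ (by linarith [hs.1])]
        congr 1; ring
      have h4 := hn' _ (m2 t ht) _ h3
      rw [hα' t ht.1]
      simp only [Pi.smul_apply, smul_eq_mul, mul_left_comm _ (1 / 2 : ℝ), ← Finset.mul_sum] at h4
      exact (mul_eq_zero.1 h4).resolve_left (by norm_num)

end StronglyNullReachable

theorem exists_contDiff_eqOn_ball {E : Type*} [NormedAddCommGroup E] [NormedSpace ℝ E]
    [HasContDiffBump E] [FiniteDimensional ℝ E] {g : E → ℝ} {p : E} {ρ : ℝ} (hρ : 0 < ρ)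
    (hg : ContDiffOn ℝ ∞ g (ball p ρ)) :
    ∃ G : E → ℝ, ContDiff ℝ ∞ G ∧ EqOn G g (ball p (ρ / 3)) := by
  let f : ContDiffBump p := ⟨ρ / 3, ρ / 2, by positivity, by linarith⟩
  refine ⟨fun x => f x * g x, contDiff_iff_contDiffAt.2 fun x => ?_, fun x hx => ?_⟩
  · by_cases hx : x ∈ ball p ρ
    · exact f.contDiffAt.mul (hg.contDiffAt (isOpen_ball.mem_nhds hx))
    · have hx' : x ∉ tsupport f := by
        rw [f.tsupport_eq]
        exact fun h => hx (closedBall_subset_ball (show ρ / 2 < ρ by linarith) h)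
      refine (contDiffAt_const (c := (0 : ℝ))).congr_of_eventuallyEq ?_
      filter_upwards [notMem_tsupport_iff_eventuallyEq.1 hx'] with y hy
      simp [hy]
  · simp [f.one_of_mem_closedBall (ball_subset_closedBall hx)]

/-- Near `p` there are coordinates in which the `i`-th coordinate is constant along the curves
`c' = v + (∑ j ≠ i, v j * a j) e i` that issue from the line through `p` in direction `e i`. -/
theorem exists_radial_coordinates {n : ℕ} (p : Fin n → ℝ) (i : Fin n)
    (a : Fin n → (Fin n → ℝ) → ℝ) (ha : ∀ j, ContDiff ℝ ∞ (a j)) {δ : ℝ} (hδ : 0 < δ) :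
    ∃ e : OpenPartialHomeomorph (Fin n → ℝ) (Fin n → ℝ), p ∈ e.target ∧ e.target ⊆ ball p δ ∧
      ContDiffOn ℝ ∞ e e.source ∧ ContDiffOn ℝ ∞ e.symm e.target ∧
      ∀ y ∈ e.source, ∃ c : ℝ → Fin n → ℝ, ContDiff ℝ 1 c ∧ c 0 = Function.update p i (y i) ∧
        c 1 = e y ∧ ∀ t ∈ Icc (0 : ℝ) 1, c t ∈ e.target ∧ e.symm (c t) i = y i ∧
          HasDerivAt c (Function.update (y - p) i
            (∑ j ∈ Finset.univ.erase i, (y j - p j) * a j (c t))) t := by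
  obtain ⟨r, hr, W, hW, hWi, hWp, hζ⟩ := exists_radial_lift p i a ha hδ
  obtain ⟨e, hpe, heU, hev, hes, het⟩ :=
    exists_openPartialHomeomorph_update isOpen_ball hW (mem_ball_self hr) i hWi
  obtain ⟨r₀, hr₀, hball⟩ := Metric.isOpen_iff.1 e.open_source p hpe
  let s := min r₀ δ
  have hs : 0 < s := lt_min hr₀ hδ
  have hse : ball p s ⊆ e.source := (ball_subset_ball (min_le_left _ _)).trans hball
  let E := e.restrOpen (ball p s) isOpen_ball
  have hEs : E.source = ball p s := by
    rw [e.restrOpen_source]; exact inter_eq_right.2 hse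
  have hEt : E.target ⊆ e.target := by
    intro q hq
    have h := E.map_target hq
    rw [← E.right_inv hq]
    rw [hEs] at h
    exact e.map_source (hse h)
  have hmem : ∀ y ∈ ball p s, E y ∈ E.target := fun y hy => E.map_source (hEs.symm ▸ hy)
  have hEp : E p = p := by
    change e p = p
    rw [hev, hWp, Function.update_eq_self]
  refine ⟨E, hEp ▸ hmem p (mem_ball_self hs), ?_, ?_, het.mono hEt, ?_⟩
  · intro q hq
    have hy := E.map_target hq
    rw [hEs] at hy
    rw [← E.right_inv hq]
    set y := E.symm q
    change e y ∈ _
    obtain ⟨ζ, -, -, h⟩ := hζ y (heU (hse hy))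
    obtain ⟨h1, h2, -⟩ := h 1 (by simp)
    rw [hev, mem_ball, dist_pi_lt_iff hδ]
    intro j
    by_cases hj : j = i
    · subst hj
      simp only [one_smul, add_sub_cancel, Function.update_eq_self] at h1
      simpa [Real.dist_eq, h1] using h2
    · rw [Function.update_of_ne hj]
      exact (dist_le_pi_dist y p j).trans_lt ((mem_ball.1 hy).trans_le (min_le_right _ _))
  · rw [hEs]; exact hes.mono hse
  · intro y hy
    rw [hEs] at hy
    obtain ⟨ζ, hζs, hζ0, h⟩ := hζ y (heU (hse hy))
    have hc : ∀ t ∈ Icc (0 : ℝ) 1, Function.update (p + t • (y - p)) i (ζ t) =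
        E (Function.update (p + t • (y - p)) i (y i)) := by
      intro t ht
      change _ = e _
      rw [hev, Function.update_idem, (h t ht).1]
    refine ⟨fun t => Function.update (p + t • (y - p)) i (ζ t), ?_, ?_, ?_, fun t ht => ?_⟩
    · refine contDiff_pi.2 fun j => ?_
      by_cases hj : j = i
      · subst hj; simpa using hζs
      · simp only [Function.update_of_ne hj, Pi.add_apply, Pi.smul_apply, smul_eq_mul]
        fun_prop
    · simp [hζ0]
    · simp only [hc 1 (by simp)]; simp
    · have hy' := update_radial_mem_ball hy i ht
      refine ⟨by simpa only [hc t ht] using hmem _ hy', ?_, hasDerivAt_pi.2 fun j => ?_⟩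
      · simp only [hc t ht]
        rw [E.left_inv (hEs.symm ▸ hy')]; simp
      · by_cases hj : j = i
        · subst hj; simpa using (h t ht).2.2
        · simp only [Function.update_of_ne hj, Pi.add_apply, Pi.smul_apply, smul_eq_mul,
            Pi.sub_apply]
          simpa using ((hasDerivAt_id t).mul_const (y j - p j)).const_add (p j)

theorem sum_mul_add_smul_single_eq_zero {n : ℕ} {f a : Fin n → ℝ} {i : Fin n}
    (h : ∀ j, f j = -a j * f i) (j : Fin n) :
    ∑ k, f k * (Pi.single j 1 + a j • Pi.single i 1 : Fin n → ℝ) k = 0 := by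
  simp only [Pi.add_apply, Pi.smul_apply, smul_eq_mul, mul_add, Finset.sum_add_distrib,
    Pi.single_apply, mul_ite, mul_one, mul_zero, Finset.sum_ite_eq', Finset.mem_univ, if_true]
  rw [h j]; ring

theorem sum_mul_update_eq_zero {n : ℕ} {f a : Fin n → ℝ} {i : Fin n}
    (h : ∀ j, f j = -a j * f i) (v : Fin n → ℝ) :
    ∑ k, f k * Function.update v i (∑ j ∈ Finset.univ.erase i, v j * a j) k = 0 := by
  rw [← Finset.add_sum_erase _ _ (Finset.mem_univ i), Function.update_self, Finset.mul_sum,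
    ← Finset.sum_add_distrib]
  refine Finset.sum_eq_zero fun k hk => ?_
  rw [Function.update_of_ne (Finset.ne_of_mem_erase hk), h k]; ring

theorem isIntegrablePfaffOn_of_fderiv_eq_zero {n : ℕ} {F a : Fin n → (Fin n → ℝ) → ℝ} {i : Fin n}
    {A : Set (Fin n → ℝ)} {ψ : (Fin n → ℝ) → ℝ} (hψ : ContDiffOn ℝ ∞ ψ A)
    (hFi : ∀ q ∈ A, F i q ≠ 0) (hFa : ∀ q ∈ A, ∀ j, F j q = -a j q * F i q)
    (hψ0 : ∀ q ∈ A, fderiv ℝ ψ q ≠ 0)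
    (h : ∀ q ∈ A, ∀ j, fderiv ℝ ψ q (Pi.single j 1 + a j q • Pi.single i 1) = 0) :
    IsIntegrablePfaffOn F A := by
  have hpd : ∀ q ∈ A, ∀ j, pd ψ j q = -a j q * pd ψ i q := by
    intro q hq j
    have := h q hq j
    rw [map_add, map_smul, smul_eq_mul] at this
    rw [pd, pd]; linarith
  have hi : ∀ q ∈ A, pd ψ i q ≠ 0 := by
    intro q hq h0
    refine hψ0 q hq (ContinuousLinearMap.ext fun v => ?_)
    rw [fderiv_apply_eq_sum_pd]
    exact Finset.sum_eq_zero fun j _ => by rw [hpd q hq j, h0]; ring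
  refine ⟨fun q => F i q / pd ψ i q, ψ, fun q hq => div_ne_zero (hFi q hq) (hi q hq), hψ,
    fun j q hq => ?_⟩
  have := hi q hq
  rw [hpd q hq j, hFa q hq j]
  field_simp

theorem OpenPartialHomeomorph.fderiv_symm_coord_ne_zero {n : ℕ}
    (e : OpenPartialHomeomorph (Fin n → ℝ) (Fin n → ℝ)) (he : ContDiffOn ℝ ∞ e e.source)
    (he' : ContDiffOn ℝ ∞ e.symm e.target) {q : Fin n → ℝ} (hq : q ∈ e.target) (i : Fin n) :
    fderiv ℝ (fun x => e.symm x i) q ≠ 0 := by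
  intro h0
  have h1 : (∞ : WithTop ℕ∞) ≠ 0 := by simp
  have hy := e.map_target hq
  have hd : DifferentiableAt ℝ (fun x => e.symm x i) q :=
    differentiableAt_pi.1 ((he'.contDiffAt (e.open_target.mem_nhds hq)).differentiableAt h1) i
  have hd' := (he.contDiffAt (e.open_source.mem_nhds hy)).differentiableAt h1
  have hd2 := hd.hasFDerivAt
  rw [h0, ← e.right_inv hq] at hd2
  have h2 := hd2.comp _ hd'.hasFDerivAt
  have h3 : HasFDerivAt (fun y : Fin n → ℝ => y i)
      ((0 : (Fin n → ℝ) →L[ℝ] ℝ).comp (fderiv ℝ e (e.symm q))) (e.symm q) := by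
    refine h2.congr_of_eventuallyEq ?_
    filter_upwards [e.open_source.mem_nhds hy] with y hy'
    simp [e.left_inv hy']
  have h4 := congrArg (fun L : (Fin n → ℝ) →L[ℝ] ℝ => L (Pi.single i 1))
    (h3.unique (hasFDerivAt_apply i _))
  simp at h4

/-- If a function is not stationary along a vector field at `q`, then the values of the function
along the integral curve through `q` fill a neighborhood. -/
theorem exists_integralCurve_image_open {n : ℕ} {X : (Fin n → ℝ) → Fin n → ℝ}
    (hX : ContDiff ℝ 1 X) {N : Set (Fin n → ℝ)} (hN : IsOpen N) {ψ : (Fin n → ℝ) → ℝ}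
    (hψ : ContDiffOn ℝ ∞ ψ N) {q : Fin n → ℝ} (hq : q ∈ N) (hq0 : fderiv ℝ ψ q (X q) ≠ 0) :
    ∃ γ : ℝ → Fin n → ℝ, ∃ σ > 0, γ 0 = q ∧ (∀ t ∈ Ioo (-σ) σ, γ t ∈ N) ∧
      (∀ t ∈ Ioo (-σ) σ, HasDerivAt γ (X (γ t)) t) ∧ IsOpen ((ψ ∘ γ) '' Ioo (-σ) σ) := by
  have h1 : (∞ : WithTop ℕ∞) ≠ 0 := by simp
  obtain ⟨γ, hγ0, ε, hε, hγ⟩ :=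
    hX.contDiffAt.exists_forall_mem_closedBall_exists_eq_forall_mem_Ioo_hasDerivAt₀ (x₀ := q) 0
  simp only [zero_sub, zero_add] at hγ
  have hcont0 : ContinuousAt γ 0 := (hγ 0 (by simpa using hε)).continuousAt
  have hdc : ContinuousOn (fun x => fderiv ℝ ψ x (X x)) N :=
    (hψ.continuousOn_fderiv_of_isOpen hN (by simp)).clm_apply hX.continuous.continuousOn
  have hV : IsOpen (N ∩ (fun x => fderiv ℝ ψ x (X x)) ⁻¹' {0}ᶜ) :=
    hdc.isOpen_inter_preimage hN isOpen_compl_singleton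
  have hev := hcont0.preimage_mem_nhds (hV.mem_nhds (by rw [hγ0]; exact ⟨hq, hq0⟩))
  obtain ⟨τ, hτ, hball⟩ := Metric.mem_nhds_iff.1 hev
  rw [Real.ball_eq_Ioo, zero_sub, zero_add] at hball
  have hσ : Ioo (-min ε τ) (min ε τ) ⊆ Ioo (-ε) ε ∩ Ioo (-τ) τ := fun t ht =>
    ⟨⟨by linarith [ht.1, min_le_left ε τ], by linarith [ht.2, min_le_left ε τ]⟩,
      ⟨by linarith [ht.1, min_le_right ε τ], by linarith [ht.2, min_le_right ε τ]⟩⟩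
  refine ⟨γ, min ε τ, lt_min hε hτ, hγ0, fun t ht => (hball (hσ ht).2).1,
    fun t ht => hγ t (hσ ht).1, isOpen_iff_mem_nhds.2 ?_⟩
  rintro _ ⟨t, ht, rfl⟩
  have hder : ∀ s ∈ Ioo (-min ε τ) (min ε τ),
      HasDerivAt (ψ ∘ γ) (fderiv ℝ ψ (γ s) (X (γ s))) s := fun s hs =>
    ((hψ.contDiffAt (hN.mem_nhds (hball (hσ hs).2).1)).differentiableAt
      h1).hasFDerivAt.comp_hasDerivAt s (hγ s (hσ hs).1)
  have hct : ContinuousAt (fun s => fderiv ℝ ψ (γ s) (X (γ s))) t :=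
    ContinuousAt.comp (f := γ) (g := fun x => fderiv ℝ ψ x (X x))
      (hdc.continuousAt (hN.mem_nhds (hball (hσ ht).2).1)) (hγ t (hσ ht).1).continuousAt
  have hst : HasStrictDerivAt (ψ ∘ γ) (fderiv ℝ ψ (γ t) (X (γ t))) t :=
    hasStrictDerivAt_of_hasDerivAt_of_continuousAt
      (by filter_upwards [isOpen_Ioo.mem_nhds ht] with s hs using hder s hs) hct
  rw [← hst.map_nhds_eq (hball (hσ ht).2).2]
  exact Filter.image_mem_map (isOpen_Ioo.mem_nhds ht)

/-- An integral curve of a `C¹` vector field tangent to the form is a null curve. -/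
theorem StronglyNullReachable.of_integralCurve {n : ℕ} {F : Fin n → (Fin n → ℝ) → ℝ}
    {M : Set (Fin n → ℝ)} {X : (Fin n → ℝ) → Fin n → ℝ} (hX : Continuous X)
    (hFX : ∀ q ∈ M, ∑ k, F k q * X q k = 0) {γ : ℝ → Fin n → ℝ} {σ : ℝ}
    (hγM : ∀ t ∈ Ioo (-σ) σ, γ t ∈ M) (hγ : ∀ t ∈ Ioo (-σ) σ, HasDerivAt γ (X (γ t)) t)
    {s : ℝ} (hs : s ∈ Ioo (-σ) σ) : StronglyNullReachable F M (γ 0) (γ s) := by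
  have hmem : ∀ t ∈ Icc (0 : ℝ) 1, t * s ∈ Ioo (-σ) σ := by
    intro t ht
    have hσ : 0 < σ := by linarith [hs.1, hs.2]
    rw [mem_Ioo, ← abs_lt, abs_mul, abs_of_nonneg ht.1]
    exact (mul_le_of_le_one_left (abs_nonneg s) ht.2).trans_lt (abs_lt.2 hs)
  have hγ1 : ContDiffOn ℝ 1 γ (Ioo (-σ) σ) := by
    rw [show (1 : WithTop ℕ∞) = 0 + 1 from (zero_add 1).symm,
      contDiffOn_succ_iff_deriv_of_isOpen isOpen_Ioo]
    refine ⟨fun t ht => (hγ t ht).differentiableAt.differentiableWithinAt, by simp, ?_⟩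
    refine contDiffOn_zero.2 (ContinuousOn.congr (f := fun t => X (γ t)) ?_ fun t ht =>
      (hγ t ht).deriv)
    exact hX.comp_continuousOn fun t ht => (hγ t ht).continuousAt.continuousWithinAt
  refine .of_hasDerivAt (γ := fun t => γ (t * s)) (γ' := fun t => s • X (γ (t * s))) (by simp)
    (by simp) (fun t ht => hγM _ (hmem t ht)) (fun t ht => ?_) (fun t ht => ?_) fun t ht => ?_
  · exact (hγ1.contDiffAt (isOpen_Ioo.mem_nhds (hmem t ht))).comp t
      (contDiff_id.mul contDiff_const).contDiffAt
  · have hl : HasDerivAt (fun t : ℝ => t * s) s t := by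
      simpa using (hasDerivAt_id t).mul_const s
    exact (hγ _ (hmem t ht)).scomp t hl
  · simp only [Pi.smul_apply, smul_eq_mul, mul_left_comm _ s, ← Finset.mul_sum]
    rw [hFX _ (hγM _ (hmem t ht)), mul_zero]

/-- The inaccessibility condition implies local integrability. -/
theorem exists_isIntegrablePfaffOn {n : ℕ} {B : Set (Fin n → ℝ)} (hB : IsOpen B)
    {F : Fin n → (Fin n → ℝ) → ℝ} (hF : ∀ i, ContDiffOn ℝ ∞ (F i) B)
    (H : ∀ p ∈ B, ∀ M : Set (Fin n → ℝ), M ⊆ B → IsOpen M → p ∈ M →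
      ∃ q ∈ M, ¬ NullReachable F M p q)
    {p : Fin n → ℝ} (hp : p ∈ B) {i : Fin n} (hi : F i p ≠ 0) :
    ∃ A ⊆ B, IsOpen A ∧ p ∈ A ∧ IsIntegrablePfaffOn F A := by
  have hV : IsOpen (B ∩ F i ⁻¹' {0}ᶜ) :=
    (hF i).continuousOn.isOpen_inter_preimage hB isOpen_compl_singleton
  obtain ⟨ρ, hρ, hρV⟩ := Metric.isOpen_iff.1 hV p ⟨hp, hi⟩
  have hext := fun j => exists_contDiff_eqOn_ball (g := fun x => -F j x / F i x) hρ
    (((hF j).mono fun x hx => (hρV hx).1).neg.div ((hF i).mono fun x hx => (hρV hx).1)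
      fun x hx => (hρV hx).2)
  choose a ha haF using hext
  obtain ⟨e, hpe, heδ, hes, het, hcurve⟩ :=
    exists_radial_coordinates p i a ha (show 0 < ρ / 3 by positivity)
  have heV : e.target ⊆ B ∩ F i ⁻¹' {0}ᶜ :=
    (heδ.trans (ball_subset_ball (by linarith))).trans hρV
  have hFa : ∀ q ∈ e.target, ∀ j, F j q = -a j q * F i q := by
    intro q hq j
    have hne : F i q ≠ 0 := (heV hq).2
    rw [haF j (heδ hq)]
    field_simp
  let ψ : (Fin n → ℝ) → ℝ := fun x => e.symm x i
  have hψ : ContDiffOn ℝ ∞ ψ e.target := (contDiff_apply ℝ ℝ i).comp_contDiffOn het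
  refine ⟨e.target, fun q hq => (heV hq).1, e.open_target, hpe,
    isIntegrablePfaffOn_of_fderiv_eq_zero hψ (fun q hq => (heV hq).2) hFa
      (fun q hq => e.fderiv_symm_coord_ne_zero hes het hq i) ?_⟩
  by_contra! hne
  obtain ⟨q₁, hq₁, j, hj⟩ := hne
  let X : (Fin n → ℝ) → Fin n → ℝ := fun q => Pi.single j 1 + a j q • Pi.single i 1
  have hX : ContDiff ℝ 1 X :=
    contDiff_const.add (((ha j).of_le (by norm_cast)).smul contDiff_const)
  obtain ⟨γ, σ, hσ, hγ0, hγN, hγ, hJ⟩ :=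
    exists_integralCurve_image_open hX e.open_target hψ hq₁ hj
  set J := (ψ ∘ γ) '' Ioo (-σ) σ
  let M : Set (Fin n → ℝ) := e.target ∩ ψ ⁻¹' J
  have hγM : ∀ t ∈ Ioo (-σ) σ, γ t ∈ M := fun t ht => ⟨hγN t ht, t, ht, rfl⟩
  have hq₁M : q₁ ∈ M := hγ0 ▸ hγM 0 (by simpa using hσ)
  obtain ⟨q, hqM, hq⟩ := H q₁ (heV hq₁).1 M (fun q hq => (heV hq.1).1)
    (hψ.continuousOn.isOpen_inter_preimage e.open_target hJ) hq₁M
  have hrad : ∀ q ∈ M, StronglyNullReachable F M (Function.update p i (ψ q)) q := by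
    intro q hq
    obtain ⟨c, hc1, hc0, hc1', hc⟩ := hcurve _ (e.map_target hq.1)
    refine .of_hasDerivAt hc0 (hc1'.trans (e.right_inv hq.1)) (fun t ht => ⟨(hc t ht).1, ?_⟩)
      (fun t _ => hc1.contDiffAt) (fun t ht => (hc t ht).2.2) fun t ht => ?_
    · change e.symm (c t) i ∈ J
      rw [(hc t ht).2.1]; exact hq.2
    · exact sum_mul_update_eq_zero (f := fun k => F k (c t)) (a := fun k => a k (c t))
        (hFa _ (hc t ht).1) (e.symm q - p)
  obtain ⟨s, hs, hsq⟩ := hqM.2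
  have h1 : StronglyNullReachable F M q₁ (γ s) := by
    rw [← hγ0]
    exact .of_integralCurve hX.continuous (fun q hq => sum_mul_add_smul_single_eq_zero
      (f := fun k => F k q) (a := fun k => a k q) (hFa q hq.1) j) hγM hγ hs
  have h2 := hrad _ (hγM s hs)
  rw [show ψ (γ s) = ψ q from hsq] at h2
  exact hq ((h1.trans h2.symm).trans (hrad q hqM)).nullReachable

/-- (Carathéodory's theorem) The Pfaffian form with smooth, nowhere-vanishing coefficients
`F i` on an open set `B ⊆ ℝⁿ` is locally integrable on `B` iff every open neighborhood
`M ⊆ B` of every point `p ∈ B` contains a point `q` unreachable from `p` along null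
curves of the form contained in `M`. -/
theorem caratheodory_theorem
    (n : ℕ) (B : Set (Fin n → ℝ)) (hB : IsOpen B)
    (F : Fin n → (Fin n → ℝ) → ℝ)
    (hF : ∀ i, ContDiffOn ℝ (⊤ : ℕ∞) (F i) B)
    (hF0 : ∀ x ∈ B, (fun i => F i x) ≠ 0) :
    IsLocallyIntegrablePfaffOn F B ↔
      ∀ p ∈ B, ∀ M : Set (Fin n → ℝ), M ⊆ B → IsOpen M → p ∈ M →
        ∃ q ∈ M, ¬ NullReachable F M p q := by
  constructor
  · intro h p hp M hMB hM hpM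
    refine exists_not_nullReachable (fun x hx => hF0 x (hMB hx)) (fun x hx => ?_) hpM
    obtain ⟨A, -, hA, hxA, hFint⟩ := h x (hMB hx)
    exact ⟨A ∩ M, inter_subset_right, hA.inter hM, ⟨hxA, hx⟩, hFint.mono inter_subset_left⟩
  · intro H p hp
    obtain ⟨i, hi⟩ := Function.ne_iff.1 (hF0 p hp)
    exact exists_isIntegrablePfaffOn hB hF H hp hi
end

section
/- (Global integrability from unreachability along a surrounding line) Let B ⊆ ℝⁿ be an open set and let F₁,…,Fₙ : B → ℝ be C^∞ functions with Fₙ(x) ≠ 0 for every x ∈ B, the coefficient functions of the Pfaffian form δξ = Σᵢ Fᵢ dxᵢ. Suppose that for every point p ∈ B there is an index i ∈ {1,…,n} such that there exist points of the surrounding line Π_i(p) = { p + t·e_i : t ∈ ℝ } ∩ B arbitrarily close to p that are not reachable from p along null curves of δξ contained in B. Then δξ is integrable on B up to a set of measure zero: there exist a set N ⊆ B of Lebesgue measure zero and functions μ, ψ : B → ℝ such that at every point x ∈ B \ N the function ψ is differentiable, μ(x) ≠ 0, and Fᵢ(x) = μ(x) · ∂ψ/∂xᵢ(x) for all i. -/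
open Set

section ODE

open Metric Function
open scoped NNReal Topology

variable {E : Type*} [NormedAddCommGroup E] [NormedSpace ℝ E]

/-- A Picard–Lindelöf vector field admits solutions that stay in the closed ball on which the
hypotheses are stated. -/
theorem IsPicardLindelof.exists_mem_closedBall_hasDerivWithinAt [CompleteSpace E]
    {f : ℝ → E → E} {tmin tmax : ℝ} {t₀ : Icc tmin tmax} {x₀ x : E} {a r L K : ℝ≥0}
    (hf : IsPicardLindelof f t₀ x₀ a r L K) (hx : x ∈ closedBall x₀ r) :
    ∃ α : ℝ → E, α t₀ = x ∧ ∀ t ∈ Icc tmin tmax,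
      α t ∈ closedBall x₀ a ∧ HasDerivWithinAt α (f t (α t)) (Icc tmin tmax) t := by
  obtain ⟨α, hα⟩ := ODE.FunSpace.exists_isFixedPt_next hf hx
  refine ⟨α.compProj, by rw [ODE.FunSpace.compProj_val, ← hα, ODE.FunSpace.next_apply₀],
    fun t ht ↦ ⟨α.compProj_mem_closedBall hf.mul_max_le, ?_⟩⟩
  apply ODE.hasDerivWithinAt_picard_Icc t₀.2 hf.continuousOn_uncurry
    α.continuous_compProj.continuousOn (fun _ _ ↦ α.compProj_mem_closedBall hf.mul_max_le)
    x ht |>.congr_of_mem _ ht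
  intro t' ht'
  nth_rw 1 [← hα]
  rw [ODE.FunSpace.compProj_of_mem ht', ODE.FunSpace.next_apply]

/-- A family of vector fields `X v`, jointly `C¹` in the parameter `v` and the point and vanishing
for `v = 0`, has solutions up to time `1` for small parameters, and these fields are uniformly
Lipschitz in the point and in the parameter. -/
theorem exists_unit_time_solutions [CompleteSpace E] {X : E → E → E} {p : E}
    (hX : ContDiffAt ℝ 1 (uncurry X) (0, p)) (h0 : ∀ y, X 0 y = 0) {U : Set E} (hU : U ∈ 𝓝 p) :
    ∃ ρ > (0 : ℝ), ∃ K : ℝ≥0, ∃ S ⊆ U, ball p ρ ⊆ S ∧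
      (∀ v ∈ ball (0 : E) ρ, LipschitzOnWith K (X v) S) ∧
      (∀ v ∈ ball (0 : E) ρ, ∀ w ∈ ball (0 : E) ρ, ∀ y ∈ S,
        dist (X v y) (X w y) ≤ K * dist v w) ∧
      ∀ v ∈ ball (0 : E) ρ, ∀ y ∈ ball p ρ, ∃ α : ℝ → E, α 0 = y ∧
        ∀ t ∈ Icc (0 : ℝ) 1, α t ∈ S ∧ HasDerivWithinAt α (X v (α t)) (Icc 0 1) t := by
  obtain ⟨K, s, hs, hl⟩ := hX.exists_lipschitzOnWith
  have hs' : s ∩ univ ×ˢ U ∈ 𝓝 ((0 : E), p) :=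
    Filter.inter_mem hs (prod_mem_nhds Filter.univ_mem hU)
  obtain ⟨a, ha, has⟩ := nhds_basis_closedBall.mem_iff.1 hs'
  lift a to ℝ≥0 using ha.le
  have mem {v y : E} (hv : v ∈ closedBall (0 : E) a) (hy : y ∈ closedBall p a) :
      (v, y) ∈ s ∩ univ ×ˢ U := has (by
    rw [← closedBall_prod_same]
    exact ⟨hv, hy⟩)
  have hlip (v : E) (hv : v ∈ closedBall (0 : E) a) :
      LipschitzOnWith K (X v) (closedBall p a) := by
    refine LipschitzOnWith.of_dist_le_mul fun y hy z hz ↦ ?_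
    simpa [Prod.dist_eq] using hl.dist_le_mul _ (mem hv hy).1 _ (mem hv hz).1
  have hpar (v : E) (hv : v ∈ closedBall (0 : E) a) (w : E) (hw : w ∈ closedBall (0 : E) a)
      (y : E) (hy : y ∈ closedBall p a) : dist (X v y) (X w y) ≤ K * dist v w := by
    simpa [Prod.dist_eq] using hl.dist_le_mul _ (mem hv hy).1 _ (mem hw hy).1
  set ρ : ℝ≥0 := a / (K + 1) with hρ
  have hρa : ρ ≤ a := div_le_self zero_le (by simp)
  have hρ0 : 0 < ρ := div_pos (by exact_mod_cast ha) (by positivity)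
  have hKρ : (K : ℝ) * ρ + ρ = a := by
    have : ((ρ : ℝ≥0) : ℝ) = a / (K + 1) := by simp [hρ]
    rw [this]
    field_simp
  have hsub (x : E) : ball x (ρ : ℝ) ⊆ closedBall x a :=
    ball_subset_closedBall.trans (closedBall_subset_closedBall (by exact_mod_cast hρa))
  refine ⟨ρ, by exact_mod_cast hρ0, K, closedBall p a,
    fun y hy ↦ (mem (mem_closedBall_self a.2) hy).2.2, hsub p, fun v hv ↦ hlip v (hsub 0 hv),
    fun v hv w hw ↦ hpar v (hsub 0 hv) w (hsub 0 hw), fun v hv y hy ↦ ?_⟩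
  have hPL : IsPicardLindelof (fun _ ↦ X v) (tmin := 0) (tmax := 1) ⟨0, by simp⟩ p a ρ (K * ρ)
      K := by
    refine IsPicardLindelof.of_time_independent (fun x hx ↦ ?_) (hlip v (hsub 0 hv)) ?_
    · have := hpar v (hsub 0 hv) 0 (mem_closedBall_self a.2) x hx
      rw [h0, dist_zero_right, dist_zero_right] at this
      rw [mem_ball_zero_iff] at hv
      exact this.trans (by push_cast; gcongr)
    · simp
      linarith
  exact hPL.exists_mem_closedBall_hasDerivWithinAt (ball_subset_closedBall hy)

theorem HasDerivWithinAt.Ici_of_Icc {f : ℝ → E} {f' : E} {a b t : ℝ}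
    (h : HasDerivWithinAt f f' (Icc a b) t) (ht : t ∈ Ico a b) : HasDerivWithinAt f f' (Ici t) t :=
  h.mono_of_mem_nhdsWithin (Icc_mem_nhdsGE_of_mem ht)

/-- Lipschitz dependence of solutions on the initial point and on a parameter. -/
theorem dist_solution_one_le {X Y : E → E} {S : Set E} {K : ℝ≥0} {d : ℝ} {α β : ℝ → E}
    (hX : LipschitzOnWith K X S) (hXY : ∀ y ∈ S, dist (Y y) (X y) ≤ K * d)
    (hα : ∀ t ∈ Icc (0 : ℝ) 1, α t ∈ S ∧ HasDerivWithinAt α (X (α t)) (Icc 0 1) t)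
    (hβ : ∀ t ∈ Icc (0 : ℝ) 1, β t ∈ S ∧ HasDerivWithinAt β (Y (β t)) (Icc 0 1) t)
    (hd : dist (α 0) (β 0) ≤ d) :
    dist (α 1) (β 1) ≤ d * gronwallBound 1 K K 1 := by
  have := dist_le_of_approx_trajectories_ODE_of_mem (v := fun _ ↦ X) (s := fun _ ↦ S) (εf := 0)
    (fun _ _ ↦ hX) (HasDerivWithinAt.continuousOn fun t ht ↦ (hα t ht).2)
    (fun t ht ↦ (hα t (Ico_subset_Icc_self ht)).2.Ici_of_Icc ht) (fun _ _ ↦ (dist_self _).le)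
    (fun t ht ↦ (hα t (Ico_subset_Icc_self ht)).1)
    (HasDerivWithinAt.continuousOn fun t ht ↦ (hβ t ht).2)
    (fun t ht ↦ (hβ t (Ico_subset_Icc_self ht)).2.Ici_of_Icc ht)
    (fun t ht ↦ hXY _ (hβ t (Ico_subset_Icc_self ht)).1)
    (fun t ht ↦ (hβ t (Ico_subset_Icc_self ht)).1) hd 1 (by simp)
  refine this.trans_eq ?_
  unfold gronwallBound
  split_ifs <;> ring_nf

/-- Solutions of a Lipschitz vector field do not contract too fast. -/
theorem dist_solution_zero_le {X : E → E} {S : Set E} {K : ℝ≥0} {α β : ℝ → E}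
    (hX : LipschitzOnWith K X S)
    (hα : ∀ t ∈ Icc (0 : ℝ) 1, α t ∈ S ∧ HasDerivWithinAt α (X (α t)) (Icc 0 1) t)
    (hβ : ∀ t ∈ Icc (0 : ℝ) 1, β t ∈ S ∧ HasDerivWithinAt β (X (β t)) (Icc 0 1) t) :
    dist (α 0) (β 0) ≤ dist (α 1) (β 1) * gronwallBound 1 K K 1 := by
  have key (γ : ℝ → E)
      (hγ : ∀ t ∈ Icc (0 : ℝ) 1, γ t ∈ S ∧ HasDerivWithinAt γ (X (γ t)) (Icc 0 1) t) (t : ℝ)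
      (ht : t ∈ Icc (0 : ℝ) 1) : γ (1 - t) ∈ S ∧
        HasDerivWithinAt (fun t ↦ γ (1 - t)) ((-X) (γ (1 - t))) (Icc 0 1) t := by
    have ht' : 1 - t ∈ Icc (0 : ℝ) 1 := ⟨by linarith [ht.2], by linarith [ht.1]⟩
    refine ⟨(hγ _ ht').1, ?_⟩
    have := (hγ _ ht').2.scomp t ((hasDerivWithinAt_id t (Icc 0 1)).const_sub 1)
      fun u hu ↦ ⟨by linarith [hu.2], by linarith [hu.1]⟩
    simpa using! this
  have := dist_solution_one_le (Y := -X) (d := dist (α 1) (β 1)) hX.neg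
    (fun y _ ↦ by rw [dist_self]; positivity) (key α hα) (key β hβ) (by simp)
  simpa using this

end ODE

section Reachability

open scoped Topology

variable {n : ℕ} {F : Fin n → (Fin n → ℝ) → ℝ} {M : Set (Fin n → ℝ)} {p q r : Fin n → ℝ}

/-- `q` is reachable from `p` along a `C¹` null curve in `M` defined for all times, which rests
at `p` until time `0` and at `q` from time `1` on. Unlike for `NullReachable`, such curves can be
concatenated without smoothness issues. -/
def SmoothNullReachable (F : Fin n → (Fin n → ℝ) → ℝ) (M : Set (Fin n → ℝ))
    (p q : Fin n → ℝ) : Prop :=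
  ∃ γ γ' : ℝ → (Fin n → ℝ), (∀ t, HasDerivAt γ (γ' t) t) ∧ Continuous γ' ∧ (∀ t, γ t ∈ M) ∧
    (∀ t, ∑ i, F i (γ t) * γ' t i = 0) ∧ (∀ t ≤ 0, γ t = p) ∧ (∀ t ≥ 1, γ t = q)

namespace SmoothNullReachable

theorem nullReachable (h : SmoothNullReachable F M p q) : NullReachable F M p q := by
  obtain ⟨γ, γ', hγ, hγ', hM, hF, h0, h1⟩ := h
  refine ⟨γ, ∅, (HasDerivAt.continuousOn fun t _ ↦ hγ t), fun t _ ↦ hM t, h0 0 le_rfl,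
    h1 1 le_rfl, fun t _ _ ↦ ContDiff.contDiffAt ?_, fun t _ _ ↦ ?_⟩
  · rw [contDiff_one_iff_deriv, show deriv γ = γ' from funext fun t ↦ (hγ t).deriv]
    exact ⟨fun t ↦ (hγ t).differentiableAt, hγ'⟩
  · rw [(hγ t).deriv, hF]

theorem right_mem (h : SmoothNullReachable F M p q) : q ∈ M := by
  obtain ⟨γ, γ', -, -, hM, -, -, h1⟩ := h
  exact h1 1 le_rfl ▸ hM 1

theorem symm (h : SmoothNullReachable F M p q) : SmoothNullReachable F M q p := by
  obtain ⟨γ, γ', hγ, hγ', hM, hF, h0, h1⟩ := h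
  refine ⟨fun t ↦ γ (1 - t), fun t ↦ -γ' (1 - t), fun t ↦ ?_, by fun_prop, fun t ↦ hM _,
    fun t ↦ ?_, fun t ht ↦ h1 _ (by linarith), fun t ht ↦ h0 _ (by linarith)⟩
  · simpa using! (hγ (1 - t)).scomp t ((hasDerivAt_id t).const_sub 1)
  · simp [hF]

theorem trans (h : SmoothNullReachable F M p q) (h' : SmoothNullReachable F M q r) :
    SmoothNullReachable F M p r := by
  obtain ⟨γ, γ', hγ, hγ', hM, hF, h0, h1⟩ := h
  obtain ⟨η, η', hη, hη', hM', hF', h0', h1'⟩ := h'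
  have hγ1 (t : ℝ) (ht : 1 ≤ t) : γ' t = 0 :=
    (uniqueDiffWithinAt_Ici t).eq_deriv _ (hγ t).hasDerivWithinAt
      ((hasDerivWithinAt_const t _ q).congr (fun s hs ↦ h1 s (ht.trans hs)) (h1 t ht))
  have hη0 (t : ℝ) (ht : t ≤ 0) : η' t = 0 :=
    (uniqueDiffWithinAt_Iic t).eq_deriv _ (hη t).hasDerivWithinAt
      ((hasDerivWithinAt_const t _ q).congr (fun s hs ↦ h0' s (le_trans hs ht)) (h0' t ht))
  refine ⟨fun t ↦ γ (2 * t) + η (2 * t - 1) - q, fun t ↦ (2 : ℝ) • γ' (2 * t) +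
    (2 : ℝ) • η' (2 * t - 1), fun t ↦ ?_, by fun_prop, fun t ↦ ?_, fun t ↦ ?_, fun t ht ↦ ?_,
    fun t ht ↦ ?_⟩
  · have d1 := (hγ (2 * t)).scomp t ((hasDerivAt_id t).const_mul (2 : ℝ))
    have d2 := (hη (2 * t - 1)).scomp t (((hasDerivAt_id t).const_mul (2 : ℝ)).sub_const 1)
    simpa using! (d1.add d2).sub_const q
  · rcases le_total t (1 / 2) with ht | ht
    · simpa [h0' (2 * t - 1) (by linarith)] using hM (2 * t)
    · simpa [h1 (2 * t) (by linarith)] using hM' (2 * t - 1)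
  · rcases le_total t (1 / 2) with ht | ht
    · simp [h0' (2 * t - 1) (by linarith), hη0 (2 * t - 1) (by linarith), mul_left_comm _ (2 : ℝ),
        ← Finset.mul_sum, hF]
    · simp [h1 (2 * t) (by linarith), hγ1 (2 * t) (by linarith), mul_left_comm _ (2 : ℝ),
        ← Finset.mul_sum, hF']
  · simp [h0 (2 * t) (by linarith), h0' (2 * t - 1) (by linarith)]
  · simp [h1 (2 * t) (by linarith), h1' (2 * t - 1) (by linarith)]

/-- The endpoints of a `C¹` null curve on a compact interval are reachable from each other. -/
theorem of_hasDerivWithinAt {b : ℝ} (hb : 0 ≤ b) {α α' : ℝ → (Fin n → ℝ)}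
    (hα : ∀ t ∈ Icc 0 b, HasDerivWithinAt α (α' t) (Icc 0 b) t) (hα' : ContinuousOn α' (Icc 0 b))
    (hM : ∀ t ∈ Icc 0 b, α t ∈ M) (hF : ∀ t ∈ Icc 0 b, ∑ i, F i (α t) * α' t i = 0) :
    SmoothNullReachable F M (α 0) (α b) := by
  set θ : ℝ → ℝ := fun t ↦ b * Real.smoothTransition t with hθ
  have hθs : ContDiff ℝ 1 θ := contDiff_const.mul Real.smoothTransition.contDiff
  have hθm (t : ℝ) : θ t ∈ Icc 0 b :=
    ⟨mul_nonneg hb (Real.smoothTransition.nonneg t),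
      mul_le_of_le_one_right hb (Real.smoothTransition.le_one t)⟩
  have hθd (t : ℝ) : HasDerivAt θ (deriv θ t) t :=
    (hθs.differentiable one_ne_zero t).hasDerivAt
  refine ⟨α ∘ θ, fun t ↦ deriv θ t • α' (θ t), fun t ↦ ?_, ?_, fun t ↦ hM _ (hθm t), fun t ↦ ?_,
    fun t ht ↦ ?_, fun t ht ↦ ?_⟩
  · rw [← hasDerivWithinAt_univ]
    exact (hα _ (hθm t)).scomp t (hθd t).hasDerivWithinAt fun s _ ↦ hθm s
  · exact (hθs.continuous_deriv_one).smul (hα'.comp_continuous hθs.continuous hθm)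
  · simp [mul_left_comm _ (deriv θ t), ← Finset.mul_sum, hF _ (hθm t)]
  · simp [hθ, Real.smoothTransition.zero_of_nonpos ht]
  · simp [hθ, Real.smoothTransition.one_of_one_le ht]

end SmoothNullReachable

/-- The projection of `v` along the `l`-th coordinate axis to the kernel at `y` of the form with
coefficients `F`. -/
noncomputable def horizontalLift (F : Fin n → (Fin n → ℝ) → ℝ) (l : Fin n) (v y : Fin n → ℝ) :
    Fin n → ℝ :=
  v - ((∑ i, F i y * v i) / F l y) • Pi.single l 1

theorem sum_mul_horizontalLift {l : Fin n} {y : Fin n → ℝ} (hl : F l y ≠ 0) (v : Fin n → ℝ) :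
    ∑ i, F i y * horizontalLift F l v y i = 0 := by
  simp [horizontalLift, mul_sub, Finset.sum_sub_distrib, Pi.single_apply]
  field_simp
  simp

theorem horizontalLift_zero (l : Fin n) (y : Fin n → ℝ) : horizontalLift F l 0 y = 0 := by
  simp [horizontalLift]

theorem horizontalLift_of_sum_eq_zero (l : Fin n) {v y : Fin n → ℝ} (h : ∑ i, F i y * v i = 0) :
    horizontalLift F l v y = v := by
  simp [horizontalLift, h]

theorem horizontalLift_apply_of_ne {l j : Fin n} (h : j ≠ l) (v y : Fin n → ℝ) :
    horizontalLift F l v y j = v j := by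
  simp [horizontalLift, h]

theorem horizontalLift_add_single {l : Fin n} {y : Fin n → ℝ} (hl : F l y ≠ 0) (v : Fin n → ℝ)
    (t : ℝ) :
    horizontalLift F l (v + t • Pi.single l 1) y = horizontalLift F l v y := by
  ext j
  simp only [horizontalLift, Pi.add_apply, Pi.sub_apply, Pi.smul_apply, smul_eq_mul, mul_add,
    Finset.sum_add_distrib]
  simp [Pi.single_apply]
  split_ifs
  · field_simp
    ring
  · simp

theorem contDiffAt_horizontalLift {l : Fin n} {v y : Fin n → ℝ}
    (hF : ∀ i, ContDiffAt ℝ 1 (F i) y) (hl : F l y ≠ 0) :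
    ContDiffAt ℝ 1 (Function.uncurry (horizontalLift F l)) (v, y) := by
  have h (i : Fin n) : ContDiffAt ℝ 1 (fun q : (Fin n → ℝ) × (Fin n → ℝ) ↦ F i q.2) (v, y) :=
    (hF i).comp (v, y) contDiffAt_snd
  have h' (i : Fin n) : ContDiffAt ℝ 1 (fun q : (Fin n → ℝ) × (Fin n → ℝ) ↦ q.1 i) (v, y) := by
    fun_prop
  refine contDiffAt_fst.sub (ContDiffAt.smul (ContDiffAt.div ?_ (h l) hl) contDiffAt_const)
  exact ContDiffAt.sum fun i _ ↦ (h i).mul (h' i)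

end Reachability

section Integrability

open Metric MeasureTheory
open scoped NNReal Topology

variable {n : ℕ} {F : Fin n → (Fin n → ℝ) → ℝ} {B : Set (Fin n → ℝ)} {l : Fin n}
  {p : Fin n → ℝ}

theorem eq_add_of_hasDerivWithinAt_const {f : ℝ → ℝ} {c : ℝ}
    (h : ∀ t ∈ Icc (0 : ℝ) 1, HasDerivWithinAt f c (Icc 0 1) t) : f 1 = f 0 + c := by
  have h' (t : ℝ) (ht : t ∈ Icc (0 : ℝ) 1) :
      HasDerivWithinAt (fun t ↦ f t - t * c) 0 (Icc 0 1) t := by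
    simpa using! (h t ht).sub ((hasDerivWithinAt_id t _).mul_const c)
  have := constant_of_has_deriv_right_zero (HasDerivWithinAt.continuousOn h')
    (fun t ht ↦ (h' t (Ico_subset_Icc_self ht)).Ici_of_Icc ht) 1 (by simp)
  simp only [one_mul, zero_mul, sub_zero] at this
  linarith

/-- Near each point `p`, transport along null curves over segments ending over `p` defines a
Lipschitz function `ψ`, the height at which the vertical line through `p` is reached. Moreover `ψ`
is expanding up to a constant along vertical lines. -/
theorem exists_lipschitz_height (hB : IsOpen B) (hF : ∀ i, ContDiffOn ℝ 1 (F i) B)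
    (hl : ∀ x ∈ B, F l x ≠ 0) (hp : p ∈ B) :
    ∃ ρ > (0 : ℝ), ∃ C : ℝ≥0, ∃ ψ : (Fin n → ℝ) → ℝ, ball p ρ ⊆ B ∧
      LipschitzOnWith C ψ (ball p ρ) ∧ ψ p = 0 ∧
      (∀ y ∈ ball p ρ, SmoothNullReachable F B y (p + ψ y • Pi.single l 1)) ∧
      ∀ y ∈ ball p ρ, ∀ t : ℝ, y + t • Pi.single l 1 ∈ ball p ρ →
        |t| ≤ C * |ψ (y + t • Pi.single l 1) - ψ y| := by
  obtain ⟨ρ, hρ, K, S, hSB, hρS, hX, hpar, hsol⟩ := exists_unit_time_solutions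
    (contDiffAt_horizontalLift (v := 0) (fun i ↦ (hF i).contDiffAt (hB.mem_nhds hp)) (hl p hp))
    (horizontalLift_zero l) (hB.mem_nhds hp)
  have hv {y : Fin n → ℝ} (hy : y ∈ ball p ρ) : p - y ∈ ball (0 : Fin n → ℝ) ρ := by
    rwa [mem_ball_zero_iff, ← dist_eq_norm, ← mem_ball']
  choose! α hα0 hα using fun y (hy : y ∈ ball p ρ) ↦ hsol (p - y) (hv hy) y hy
  set ψ : (Fin n → ℝ) → ℝ := fun y ↦ α y 1 l - p l with hψ
  have hα1 {y : Fin n → ℝ} (hy : y ∈ ball p ρ) : α y 1 = p + ψ y • Pi.single l 1 := by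
    ext j
    rcases eq_or_ne j l with rfl | hj
    · simp [hψ]
    · have := eq_add_of_hasDerivWithinAt_const (f := fun t ↦ α y t j) (c := (p - y) j)
        fun t ht ↦ by
          have := hasDerivWithinAt_pi.1 (hα y hy t ht).2 j
          rwa [horizontalLift_apply_of_ne hj] at this
      simpa [hα0 y hy, hj] using this
  have hdist {y z : Fin n → ℝ} (hy : y ∈ ball p ρ) (hz : z ∈ ball p ρ) :
      dist (α y 1) (α z 1) = dist (ψ y) (ψ z) := by
    rw [hα1 hy, hα1 hz, dist_add_left, dist_eq_norm, ← sub_smul, norm_smul, Pi.norm_single]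
    simp [Real.dist_eq]
  set C : ℝ≥0 := (gronwallBound 1 K K 1).toNNReal
  have hC : gronwallBound 1 K K 1 ≤ C := Real.le_coe_toNNReal _
  refine ⟨ρ, hρ, C, ψ, hρS.trans hSB, LipschitzOnWith.of_dist_le_mul fun y hy z hz ↦ ?_, ?_,
    fun y hy ↦ ?_, fun y hy t ht ↦ ?_⟩
  · rw [← hdist hy hz, mul_comm]
    refine (dist_solution_one_le (hX _ (hv hy)) (fun x hx ↦ ?_) (hα y hy) (hα z hz)
      (by rw [hα0 y hy, hα0 z hz])).trans (by gcongr)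
    simpa only [dist_sub_left, dist_comm z y] using hpar _ (hv hz) _ (hv hy) x hx
  · have hpb : p ∈ ball p ρ := mem_ball_self hρ
    have := eq_add_of_hasDerivWithinAt_const (f := fun t ↦ α p t l) (c := 0) fun t ht ↦ by
      have := hasDerivWithinAt_pi.1 (hα p hpb t ht).2 l
      simpa [horizontalLift_zero] using this
    simp [hψ, this, hα0 p hpb]
  · rw [← hα1 hy]
    nth_rw 1 [← hα0 y hy]
    have hc : ContinuousOn (α y) (Icc 0 1) :=
      HasDerivWithinAt.continuousOn fun t ht ↦ (hα y hy t ht).2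
    exact SmoothNullReachable.of_hasDerivWithinAt zero_le_one (fun t ht ↦ (hα y hy t ht).2)
      ((hX _ (hv hy)).continuousOn.comp hc fun t ht ↦ (hα y hy t ht).1)
      (fun t ht ↦ hSB (hα y hy t ht).1)
      (fun t ht ↦ sum_mul_horizontalLift (hl _ (hSB (hα y hy t ht).1)) _)
  · have h := dist_solution_zero_le (hX _ (hv hy)) (hα y hy) (β := α (y + t • Pi.single l 1))
      fun s hs ↦ ⟨(hα _ ht s hs).1, by
        have := (hα _ ht s hs).2
        rw [← horizontalLift_add_single (hl _ (hSB (hα _ ht s hs).1)) _ t] at this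
        convert! this using 2
        abel⟩
    rw [hα0 y hy, hα0 _ ht, dist_self_add_right, norm_smul, Pi.norm_single, hdist hy ht, dist_comm,
      Real.dist_eq, mul_comm _ (gronwallBound _ _ _ _)] at h
    refine le_trans (by simp) (h.trans (by gcongr))

/-- If the vertical line through `p` is traversed continuously inside one reachability class, then
it is not traversed at all: otherwise the class would contain a neighbourhood of a point. -/
theorem eq_of_smoothNullReachable (hB : IsOpen B) (hF : ∀ i, ContDiffOn ℝ 1 (F i) B)
    (hl : ∀ x ∈ B, F l x ≠ 0)
    (hline : ∀ p ∈ B, ∃ i : Fin n, ∀ ε > (0 : ℝ), ∃ t : ℝ, |t| < ε ∧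
      ¬ NullReachable F B p (p + t • (Pi.single i 1 : Fin n → ℝ)))
    {h : ℝ → ℝ} {b : ℝ} (hb : 0 ≤ b) (hc : ContinuousOn h (Icc 0 b))
    (hr : ∀ s ∈ Icc 0 b, ∀ s' ∈ Icc 0 b,
      SmoothNullReachable F B (p + h s • Pi.single l 1) (p + h s' • Pi.single l 1)) :
    h b = h 0 := by
  by_contra hne
  set m := (h 0 + h b) / 2 with hm
  set δ := |h b - h 0| / 2 with hδ
  have hδ0 : 0 < δ := half_pos (abs_pos.2 (sub_ne_zero.2 hne))
  have himg (t : ℝ) (ht : |t| < δ) : ∃ s ∈ Icc 0 b, h s = m + t := by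
    rw [← uIcc_of_le hb] at hc ⊢
    refine intermediate_value_uIcc hc ?_
    rw [mem_uIcc]
    grind
  obtain ⟨s₀, hs₀, hm₀⟩ := himg 0 (by simpa)
  rw [add_zero] at hm₀
  set q : Fin n → ℝ := p + m • Pi.single l 1 with hq
  have hqB : q ∈ B := by
    rw [hq, ← hm₀]
    exact (hr s₀ hs₀ s₀ hs₀).right_mem
  obtain ⟨ρ, hρ, C, ψ, -, hψ, hψ0, hreach, -⟩ := exists_lipschitz_height hB hF hl hqB
  have hψc : ContinuousAt ψ q := hψ.continuousOn.continuousAt (ball_mem_nhds q hρ)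
  have hnear : ∀ᶠ y in 𝓝 q, NullReachable F B q y := by
    have : ∀ᶠ y in 𝓝 q, |ψ y| < δ := by
      have := hψc.abs.eventually_lt_const (u := δ) (by simpa [hψ0] using hδ0)
      exact this
    filter_upwards [this, ball_mem_nhds q hρ] with y hy hyρ
    obtain ⟨s, hs, hsm⟩ := himg _ hy
    have h1 := hreach y hyρ
    have h2 := hr s₀ hs₀ s hs
    rw [hm₀, hsm, add_smul, ← add_assoc, ← hq] at h2
    exact (h2.trans h1.symm).nullReachable
  obtain ⟨i, hi⟩ := hline q hqB
  have hcont : Continuous fun t : ℝ ↦ q + t • (Pi.single i 1 : Fin n → ℝ) := by fun_prop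
  have hev : ∀ᶠ t : ℝ in 𝓝 0, NullReachable F B q (q + t • (Pi.single i 1 : Fin n → ℝ)) :=
    hcont.continuousAt.eventually (by simpa using hnear)
  obtain ⟨ε, hε, hball⟩ := Metric.eventually_nhds_iff.1 hev
  obtain ⟨t, ht, hnot⟩ := hi ε hε
  exact hnot (hball (by simpa using ht))

/-- Near each point there is a Lipschitz function whose gradient is a nonzero multiple of the
form wherever it exists. -/
theorem exists_lipschitz_first_integral (hB : IsOpen B) (hF : ∀ i, ContDiffOn ℝ 1 (F i) B)
    (hl : ∀ x ∈ B, F l x ≠ 0)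
    (hline : ∀ p ∈ B, ∃ i : Fin n, ∀ ε > (0 : ℝ), ∃ t : ℝ, |t| < ε ∧
      ¬ NullReachable F B p (p + t • (Pi.single i 1 : Fin n → ℝ)))
    (hp : p ∈ B) :
    ∃ ρ > (0 : ℝ), ∃ C : ℝ≥0, ∃ ψ : (Fin n → ℝ) → ℝ, LipschitzOnWith C ψ (ball p ρ) ∧
      ∀ y ∈ ball p ρ, DifferentiableAt ℝ ψ y →
        pd ψ l y ≠ 0 ∧ ∀ i, F i y = F l y / pd ψ l y * pd ψ i y := by
  obtain ⟨ρ, hρ, C, ψ, hρB, hψ, -, hreach, hexp⟩ := exists_lipschitz_height hB hF hl hp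
  refine ⟨ρ, hρ, C, ψ, hψ, fun y hy hd ↦ ?_⟩
  have hyB : y ∈ B := hρB hy
  have hne : pd ψ l y ≠ 0 := by
    intro h0
    have hderiv : HasDerivAt (fun t : ℝ ↦ ψ (y + t • Pi.single l 1)) 0 0 := by
      have h := hd.hasFDerivAt.hasLineDerivAt (Pi.single l 1)
      rwa [HasLineDerivAt, show fderiv ℝ ψ y (Pi.single l 1) = 0 from h0] at h
    have hcont : Continuous fun t : ℝ ↦ y + t • (Pi.single l 1 : Fin n → ℝ) := by fun_prop
    have hmem : ∀ᶠ t : ℝ in 𝓝 0, y + t • (Pi.single l 1 : Fin n → ℝ) ∈ ball p ρ :=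
      hcont.continuousAt.eventually (isOpen_ball.mem_nhds (by simpa using hy))
    have hsmall := hderiv.isLittleO.def (c := 1 / (2 * (C + 1))) (by positivity)
    obtain ⟨t, ⟨ht1, ht2⟩, ht0⟩ := ((hmem.and hsmall).filter_mono nhdsWithin_le_nhds |>.and
      (self_mem_nhdsWithin : ∀ᶠ t in 𝓝[≠] (0 : ℝ), t ∈ ({0}ᶜ : Set ℝ))).exists
    simp only [sub_zero, smul_zero, zero_smul, add_zero, Real.norm_eq_abs] at ht2
    have ht3 : |t| ≤ C * (1 / (2 * (C + 1)) * |t|) := (hexp y hy t ht1).trans (by gcongr)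
    have ht4 : 0 < |t| := abs_pos.2 ht0
    have hC : (C : ℝ) * (1 / (2 * (C + 1))) < 1 := by
      rw [mul_one_div, div_lt_one (by positivity)]
      linarith [C.2]
    nlinarith
  have hker (v : Fin n → ℝ) : fderiv ℝ ψ y (horizontalLift F l v y) = 0 := by
    have hX : ContDiffAt ℝ 1 (horizontalLift F l v) y :=
      (contDiffAt_horizontalLift (fun i ↦ (hF i).contDiffAt (hB.mem_nhds hyB)) (hl y hyB)).comp y
        (contDiffAt_const.prodMk contDiffAt_id)
    obtain ⟨α, hα0, ε, hε, hα⟩ :=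
      hX.exists_forall_mem_closedBall_exists_eq_forall_mem_Ioo_hasDerivAt₀ 0
    simp only [zero_sub, zero_add] at hα
    have hαd := hα 0 ⟨by linarith, hε⟩
    have hmem : ∀ᶠ t in 𝓝 0, t ∈ Ioo (-ε) ε ∧ α t ∈ ball p ρ :=
      Filter.Eventually.and (Ioo_mem_nhds (neg_neg_of_pos hε) hε)
        (hαd.continuousAt.eventually (by rw [hα0]; exact isOpen_ball.mem_nhds hy))
    obtain ⟨δ, hδ, hδm⟩ := nhds_basis_closedBall.mem_iff.1 hmem
    have hδm' (t : ℝ) (ht : t ∈ Icc 0 δ) : t ∈ Ioo (-ε) ε ∧ α t ∈ ball p ρ :=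
      hδm (by simpa [abs_of_nonneg ht.1] using ht.2)
    have hαc : ContinuousOn α (Icc 0 δ) := HasDerivAt.continuousOn fun t ht ↦ hα t (hδm' t ht).1
    have hlift : ContinuousOn (fun t ↦ horizontalLift F l v (α t)) (Icc 0 δ) := fun t ht ↦ by
      have hB' := hρB (hδm' t ht).2
      have : ContDiffAt ℝ 1 (horizontalLift F l v) (α t) :=
        (contDiffAt_horizontalLift (fun i ↦ (hF i).contDiffAt (hB.mem_nhds hB'))
          (hl _ hB')).comp _ (contDiffAt_const.prodMk contDiffAt_id)
      exact this.continuousAt.comp_continuousWithinAt (hαc t ht)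
    have hyα (s : ℝ) (hs : s ∈ Icc 0 δ) :
        SmoothNullReachable F B y (p + ψ (α s) • Pi.single l 1) := by
      have hsub : Icc 0 s ⊆ Icc 0 δ := Icc_subset_Icc_right hs.2
      have := SmoothNullReachable.of_hasDerivWithinAt (F := F) (M := B) hs.1
        (fun t ht ↦ (hα t (hδm' t (hsub ht)).1).hasDerivWithinAt) (hlift.mono hsub)
        (fun t ht ↦ hρB (hδm' t (hsub ht)).2)
        (fun t ht ↦ sum_mul_horizontalLift (hl _ (hρB (hδm' t (hsub ht)).2)) _)
      rw [hα0] at this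
      exact this.trans (hreach _ (hδm' s hs).2)
    have hconst (s : ℝ) (hs : s ∈ Icc 0 δ) : ψ (α s) = ψ (α 0) := by
      have hsub : Icc 0 s ⊆ Icc 0 δ := Icc_subset_Icc_right hs.2
      exact eq_of_smoothNullReachable hB hF hl hline (p := p) (h := fun t ↦ ψ (α t)) hs.1
        (hψ.continuousOn.comp (hαc.mono hsub) fun t ht ↦ (hδm' t (hsub ht)).2)
        fun t ht t' ht' ↦ (hyα t (hsub ht)).symm.trans (hyα t' (hsub ht'))
    rw [hα0] at hαd
    have h1 : HasDerivAt (fun s ↦ ψ (α s)) (fderiv ℝ ψ y (horizontalLift F l v y)) 0 :=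
      HasFDerivAt.comp_hasDerivAt_of_eq 0 hd.hasFDerivAt hαd hα0.symm
    have h0 : (0 : ℝ) ∈ Icc 0 δ := left_mem_Icc.2 hδ.le
    exact ((uniqueDiffOn_Icc hδ) 0 h0).eq_deriv _ h1.hasDerivWithinAt
      ((hasDerivWithinAt_const 0 _ (ψ (α 0))).congr hconst rfl)
  refine ⟨hne, fun i ↦ ?_⟩
  have h := hker (Pi.single i 1)
  have hsum : ∑ j, F j y * (Pi.single i 1 : Fin n → ℝ) j = F i y := by simp [Pi.single_apply]
  have hly := hl y hyB
  rw [horizontalLift, hsum, map_sub, map_smul, smul_eq_mul] at h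
  change pd ψ i y - F i y / F l y * pd ψ l y = 0 at h
  rw [sub_eq_zero.1 h]
  field_simp

/-- Functions given on balls around the points of a set can be glued, away from a null set, to a
function that locally agrees with one of them. -/
theorem exists_eventuallyEq_off_null {B : Set (Fin n → ℝ)} {ρ : (Fin n → ℝ) → ℝ}
    (hρ : ∀ p ∈ B, 0 < ρ p) (ψ : (Fin n → ℝ) → (Fin n → ℝ) → ℝ)
    {Z : (Fin n → ℝ) → Set (Fin n → ℝ)} (hZ : ∀ p ∈ B, volume (Z p) = 0) :
    ∃ (N : Set (Fin n → ℝ)) (Ψ : (Fin n → ℝ) → ℝ), N ⊆ B ∧ volume N = 0 ∧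
      ∀ x ∈ B \ N, ∃ p ∈ B, x ∈ ball p (ρ p) ∧ x ∉ Z p ∧ Ψ =ᶠ[𝓝 x] ψ p := by
  obtain ⟨T, hTB, hT, hcover⟩ := TopologicalSpace.countable_cover_nhdsWithin
    (f := fun p ↦ ball p (ρ p)) fun p hp ↦ mem_nhdsWithin_of_mem_nhds (ball_mem_nhds p (hρ p hp))
  rcases B.eq_empty_or_nonempty with rfl | ⟨b, hb⟩
  · exact ⟨∅, 0, by simp⟩
  have hTne : T.Nonempty := by
    obtain ⟨p, hp, -⟩ := mem_iUnion₂.1 (hcover hb)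
    exact ⟨p, hp⟩
  obtain ⟨c, rfl⟩ := hT.exists_eq_range hTne
  have hcB (j : ℕ) : c j ∈ B := hTB (mem_range_self j)
  set k : (Fin n → ℝ) → ℕ := fun x ↦ sInf {j | x ∈ ball (c j) (ρ (c j))} with hk
  refine ⟨B ∩ ⋃ j, sphere (c j) (ρ (c j)) ∪ Z (c j), fun x ↦ ψ (c (k x)) x, inter_subset_left,
    measure_mono_null inter_subset_right (measure_iUnion_null fun j ↦ measure_union_null
      (Measure.addHaar_sphere_of_ne_zero _ _ (hρ _ (hcB j)).ne') (hZ _ (hcB j))),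
    fun x ⟨hxB, hxN⟩ ↦ ?_⟩
  have hxN' (j : ℕ) : x ∉ sphere (c j) (ρ (c j)) ∧ x ∉ Z (c j) := by
    constructor <;> intro h
    · exact hxN ⟨hxB, mem_iUnion.2 ⟨j, Or.inl h⟩⟩
    · exact hxN ⟨hxB, mem_iUnion.2 ⟨j, Or.inr h⟩⟩
  have hne : {j | x ∈ ball (c j) (ρ (c j))}.Nonempty := by
    obtain ⟨_, ⟨j, rfl⟩, hj⟩ := mem_iUnion₂.1 (hcover hxB)
    exact ⟨j, hj⟩
  have hkx : x ∈ ball (c (k x)) (ρ (c (k x))) := Nat.sInf_mem hne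
  have hlt (i : ℕ) (hi : i < k x) : x ∉ closedBall (c i) (ρ (c i)) := by
    rw [← ball_union_sphere]
    exact not_or.2 ⟨Nat.notMem_of_lt_sInf hi, (hxN' i).1⟩
  have hev : ∀ᶠ y in 𝓝 x, ∀ i ∈ Iio (k x), y ∉ closedBall (c i) (ρ (c i)) :=
    (Filter.eventually_all_finite (finite_Iio _)).2 fun i hi ↦
      isClosed_closedBall.isOpen_compl.mem_nhds (hlt i hi)
  refine ⟨c (k x), hcB _, hkx, (hxN' _).2, ?_⟩
  filter_upwards [hev, isOpen_ball.mem_nhds hkx] with y hy hyk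
  have : k y = k x := by
    refine le_antisymm (Nat.sInf_le hyk) (not_lt.1 fun h ↦ hy _ h ?_)
    exact ball_subset_closedBall (Nat.sInf_mem (s := {j | y ∈ ball (c j) (ρ (c j))}) ⟨_, hyk⟩)
  rw [this]

end Integrability

/-- (Global integrability from unreachability along a surrounding line) Let `F i` be the
smooth coefficient functions of a Pfaffian form on an open set `B ⊆ ℝⁿ`, with `Fₙ`
nowhere zero on `B`. If for every `p ∈ B` there is a coordinate direction `i` such that
the surrounding line `{p + t • eᵢ} ∩ B` contains points arbitrarily close to `p` that are
unreachable from `p` along null curves of the form contained in `B`, then the form is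
integrable on `B` up to a set of Lebesgue measure zero. -/
theorem global_integrability_surrounding_line
    (n : ℕ) (B : Set (Fin n → ℝ)) (hB : IsOpen B)
    (F : Fin n → (Fin n → ℝ) → ℝ) (hn : 0 < n)
    (hF : ∀ i, ContDiffOn ℝ (⊤ : ℕ∞) (F i) B)
    (hFn : ∀ x ∈ B, F ⟨n - 1, by omega⟩ x ≠ 0)
    (hline : ∀ p ∈ B, ∃ i : Fin n, ∀ ε > (0 : ℝ), ∃ t : ℝ, |t| < ε ∧ t ≠ 0 ∧
      p + t • (Pi.single i 1 : Fin n → ℝ) ∈ B ∧ ¬ NullReachable F B p (p + t • (Pi.single i 1 : Fin n → ℝ))) :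
    ∃ N : Set (Fin n → ℝ), N ⊆ B ∧ MeasureTheory.volume N = 0 ∧
      ∃ μ ψ : (Fin n → ℝ) → ℝ, ∀ x ∈ B \ N,
        DifferentiableAt ℝ ψ x ∧ μ x ≠ 0 ∧ ∀ i, F i x = μ x * pd ψ i x := by
  have hF1 (i : Fin n) : ContDiffOn ℝ 1 (F i) B := (hF i).of_le (by exact_mod_cast le_top)
  choose! ρ hρ C ψ hψ hgrad using fun p hp ↦ exists_lipschitz_first_integral (p := p) hB hF1 hFn
    (fun p hp ↦ (hline p hp).imp fun i hi ε hε ↦ by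
      obtain ⟨t, ht, -, -, hnot⟩ := hi ε hε
      exact ⟨t, ht, hnot⟩) hp
  obtain ⟨N, Ψ, hNB, hN, hΨ⟩ := exists_eventuallyEq_off_null hρ ψ
    (Z := fun p ↦ {x | ¬ (x ∈ Metric.ball p (ρ p) →
      DifferentiableWithinAt ℝ (ψ p) (Metric.ball p (ρ p)) x)})
    fun p hp ↦ (hψ p hp).ae_differentiableWithinAt_of_mem
  refine ⟨N, hNB, hN, fun x ↦ F ⟨n - 1, by omega⟩ x / pd Ψ ⟨n - 1, by omega⟩ x, Ψ,
    fun x hx ↦ ?_⟩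
  obtain ⟨p, hp, hxp, hxZ, heq⟩ := hΨ x hx
  have hd : DifferentiableAt ℝ (ψ p) x :=
    (not_not.1 hxZ hxp).differentiableAt (Metric.isOpen_ball.mem_nhds hxp)
  have hpd (i : Fin n) : pd Ψ i x = pd (ψ p) i x := by rw [pd, pd, heq.fderiv_eq]
  obtain ⟨hne, hform⟩ := hgrad p hp x hxp hd
  refine ⟨hd.congr_of_eventuallyEq heq, ?_, fun i ↦ ?_⟩
  · beta_reduce
    rw [hpd]
    exact div_ne_zero (hFn x hx.1) hne
  · beta_reduce
    rw [hpd, hpd]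
    exact hform i
end
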